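/- Let σ be the ring automorphism of ℂ[x,y,z] that conjugates the coefficients of a polynomial (it is semilinear over complex conjugation and fixes x, y, z), and for a ℂ-algebra automorphism g of ℂ[x,y,z] set ḡ = σ ∘ g ∘ σ. Let ν be a ℂ-algebra automorphism of ℂ[x,y,z] with ν(z) = z such that ν ∘ ν̄ = id. Then there exists a ℂ-algebra automorphism f of ℂ[x,y,z] with f(z) = z such that ν = f⁻¹ ∘ f̄. (Equivalently: H¹(Gal(ℂ/ℝ), Aut_{ℂ[z]}(ℂ[x,y,z])) is trivial, so every real structure on 𝔸³_ℂ compatible with the projection to the z-coordinate is equivalent to the standard one.) -/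

import Mathlib

open MvPolynomial

/-- Coefficientwise complex conjugation on `ℂ[x,y,z]`. -/
noncomputable def coeffConj (P : MvPolynomial (Fin 3) ℂ) : MvPolynomial (Fin 3) ℂ :=
  MvPolynomial.map (starRingEnd ℂ) P


open MvPolynomial

namespace RealForm

noncomputable abbrev ml : MonomialOrder (Fin 2) := MonomialOrder.lex

lemma le2 (a b : Fin 2 →₀ ℕ) :
    ml.toSyn a ≤ ml.toSyn b ↔ a 0 < b 0 ∨ (a 0 = b 0 ∧ a 1 ≤ b 1) := by
  rw [← not_lt]
  have : ml.toSyn b < ml.toSyn a ↔ toLex b < toLex a := Iff.rfl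
  rw [this, Finsupp.Lex.lt_iff]
  simp only [Fin.exists_fin_two, ofLex_toLex]
  constructor
  · intro h
    push Not at h
    by_cases h0 : a 0 < b 0
    · exact Or.inl h0
    · have h1 := h.1 (by intro j hj; exact absurd hj (by simp))
      have h00 : a 0 = b 0 := by omega
      refine Or.inr ⟨h00, h.2 ?_⟩
      intro j hj
      have : j = 0 := by omega
      subst this; exact h00.symm
  · rintro h (⟨h1, h2⟩ | ⟨h1, h2⟩)
    · omega
    · have := h1 0 (by simp)
      omega

lemma lt2 (a b : Fin 2 →₀ ℕ) :
    ml.toSyn a < ml.toSyn b ↔ a 0 < b 0 ∨ (a 0 = b 0 ∧ a 1 < b 1) := by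
  rw [← not_le, le2]; omega

section domain
variable {R : Type*} [CommRing R]

noncomputable def jac (f g : MvPolynomial (Fin 2) R) : MvPolynomial (Fin 2) R :=
  pderiv 0 f * pderiv 1 g - pderiv 1 f * pderiv 0 g

lemma deriv_aeval (D : Derivation R (MvPolynomial (Fin 2) R) (MvPolynomial (Fin 2) R))
    (g : Fin 2 → MvPolynomial (Fin 2) R) (H : MvPolynomial (Fin 2) R) :
    D (aeval g H) = aeval g (pderiv 0 H) * D (g 0) + aeval g (pderiv 1 H) * D (g 1) := by
  induction H using MvPolynomial.induction_on with
  | C a => simp only [aeval_C, pderiv_C, map_zero, Derivation.map_algebraMap, zero_mul, add_zero]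
  | add p q hp hq => simp only [map_add, hp, hq]; ring
  | mul_X p n hp =>
    simp only [map_mul, Derivation.leibniz, smul_eq_mul, aeval_X, map_add, hp]
    fin_cases n
    · simp [-aeval_eq_bind₁, pderiv_X]; ring
    · simp [-aeval_eq_bind₁, pderiv_X]; ring

lemma jac_aeval (g : Fin 2 → MvPolynomial (Fin 2) R) (H K : MvPolynomial (Fin 2) R) :
    jac (aeval g H) (aeval g K) = aeval g (jac H K) * jac (g 0) (g 1) := by
  simp only [jac, deriv_aeval, map_sub, map_mul]; ring

noncomputable def th (i : Fin 2) (f : MvPolynomial (Fin 2) R) : MvPolynomial (Fin 2) R :=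
  X i * pderiv i f

lemma coeff_th (i : Fin 2) (f : MvPolynomial (Fin 2) R) (d) :
    coeff d (th i f) = d i * coeff d f := by
  induction f using MvPolynomial.induction_on' with
  | monomial u a =>
    rw [th, X_mul_pderiv_monomial]
    simp only [nsmul_eq_mul]
    rw [← map_natCast (C : R →+* MvPolynomial (Fin 2) R), coeff_C_mul, coeff_monomial]
    split_ifs with h
    · rw [h]
    · simp
  | add p q hp hq =>
    simp only [th] at *
    simp [mul_add, hp, hq]

lemma coeff_th_iter (i : Fin 2) (q : ℕ) (f : MvPolynomial (Fin 2) R) (d) :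
    coeff d ((th i)^[q] f) = (d i : R) ^ q * coeff d f := by
  induction q generalizing f with
  | zero => simp
  | succ q ih => rw [Function.iterate_succ_apply, ih, coeff_th]; ring

noncomputable def br (f g : MvPolynomial (Fin 2) R) : MvPolynomial (Fin 2) R :=
  th 0 f * th 1 g - th 1 f * th 0 g

lemma br_eq (f g : MvPolynomial (Fin 2) R) : br f g = X 0 * X 1 * jac f g := by
  simp [br, th, jac]; ring

lemma br_chain (u v H : MvPolynomial (Fin 2) R) :
    v * br u (aeval ![u, v] H) = aeval ![u, v] (th 1 H) * br u v := by
  simp only [br, th, deriv_aeval, map_mul, aeval_X]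
  simp; ring

lemma deg_th_le (i : Fin 2) (f : MvPolynomial (Fin 2) R) :
    ml.toSyn (ml.degree (th i f)) ≤ ml.toSyn (ml.degree f) := by
  rw [MonomialOrder.degree_le_iff]
  intro c hc
  apply MonomialOrder.le_degree
  rw [mem_support_iff, coeff_th] at hc
  rw [mem_support_iff]
  intro h
  exact hc (by rw [h, mul_zero])

lemma coeff_br (f g : MvPolynomial (Fin 2) R) :
    coeff (ml.degree f + ml.degree g) (br f g) =
      ((ml.degree f 0 : R) * ml.degree g 1 - ml.degree f 1 * ml.degree g 0) *
       (ml.leadingCoeff f * ml.leadingCoeff g) := by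
  rw [br, coeff_sub, MonomialOrder.coeff_mul_of_add_of_degree_le (deg_th_le _ _) (deg_th_le _ _),
    MonomialOrder.coeff_mul_of_add_of_degree_le (deg_th_le _ _) (deg_th_le _ _)]
  simp only [coeff_th, MonomialOrder.leadingCoeff]
  ring

lemma deg_mul_le' (f g : MvPolynomial (Fin 2) R) (a b : Fin 2 →₀ ℕ)
    (hf : ml.toSyn (ml.degree f) ≤ ml.toSyn a) (hg : ml.toSyn (ml.degree g) ≤ ml.toSyn b) :
    ml.toSyn (ml.degree (f * g)) ≤ ml.toSyn (a + b) := by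
  refine MonomialOrder.degree_mul_le.trans ?_
  rw [map_add, map_add]
  exact add_le_add hf hg

lemma deg_br_le (f g : MvPolynomial (Fin 2) R) :
    ml.toSyn (ml.degree (br f g)) ≤ ml.toSyn (ml.degree f + ml.degree g) := by
  rw [br]
  refine MonomialOrder.degree_sub_le.trans (sup_le ?_ ?_) <;>
  exact deg_mul_le' _ _ _ _ (deg_th_le _ _) (deg_th_le _ _)

variable [IsDomain R]

lemma mon_eval (u v : MvPolynomial (Fin 2) R) (e : Fin 2 →₀ ℕ) (a b i j : ℕ)
    (hu : ml.degree u = a • e) (hv : ml.degree v = b • e) (hu0 : u ≠ 0) (hv0 : v ≠ 0) :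
    ml.degree (u ^ i * v ^ j) = (a * i + b * j) • e ∧
    coeff ((a * i + b * j) • e) (u ^ i * v ^ j) = ml.leadingCoeff u ^ i * ml.leadingCoeff v ^ j := by
  have h1 : ml.degree (u ^ i * v ^ j) = (a * i + b * j) • e := by
    rw [MonomialOrder.degree_mul (pow_ne_zero _ hu0) (pow_ne_zero _ hv0), MonomialOrder.degree_pow,
      MonomialOrder.degree_pow, hu, hv, smul_smul, smul_smul, ← add_smul]
    congr 1; ring
  refine ⟨h1, ?_⟩
  rw [← h1]
  change ml.leadingCoeff _ = _
  rw [MonomialOrder.leadingCoeff_mul, MonomialOrder.leadingCoeff_pow, MonomialOrder.leadingCoeff_pow]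

lemma smul_lt (e : Fin 2 →₀ ℕ) (he : e ≠ 0) {a b : ℕ} (h : a < b) :
    ml.toSyn (a • e) < ml.toSyn (b • e) := by
  rw [lt2]
  simp only [Finsupp.smul_apply, smul_eq_mul]
  rcases Nat.eq_zero_or_pos (e 0) with h0 | h0
  · right
    refine ⟨by simp [h0], ?_⟩
    have : e 1 ≠ 0 := by
      intro h1; apply he; ext i; fin_cases i <;> simp [h0, h1]
    exact Nat.mul_lt_mul_of_pos_right h (Nat.pos_of_ne_zero this)
  · left; exact Nat.mul_lt_mul_of_pos_right h h0

lemma aeval_sum2 (u v H : MvPolynomial (Fin 2) R) (s : Finset (Fin 2 →₀ ℕ)) (hs : H.support ⊆ s) :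
    aeval ![u, v] H = ∑ d ∈ s, C (coeff d H) * (u ^ d 0 * v ^ d 1) := by
  rw [aeval_def, eval₂_eq']
  simp only [Fin.prod_univ_two]
  simp only [Matrix.cons_val_zero, Matrix.cons_val_one, algebraMap_eq]
  apply Finset.sum_subset hs
  intro d _ hd
  rw [notMem_support_iff] at hd
  simp [hd]

open Classical in
lemma top_coeff (u v H : MvPolynomial (Fin 2) R) (e : Fin 2 →₀ ℕ) (he : e ≠ 0) (a b W : ℕ)
    (hu : ml.degree u = a • e) (hv : ml.degree v = b • e) (hu0 : u ≠ 0) (hv0 : v ≠ 0)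
    (s : Finset (Fin 2 →₀ ℕ)) (hs : H.support ⊆ s) (hW : ∀ d ∈ s, a * d 0 + b * d 1 ≤ W) :
    ml.toSyn (ml.degree (aeval ![u, v] H)) ≤ ml.toSyn (W • e) ∧
    coeff (W • e) (aeval ![u, v] H) =
      ∑ d ∈ s with a * d 0 + b * d 1 = W, coeff d H *
        (ml.leadingCoeff u ^ d 0 * ml.leadingCoeff v ^ d 1) := by
  rw [aeval_sum2 u v H s hs]
  constructor
  · refine MonomialOrder.degree_sum_le.trans (Finset.sup_le ?_)
    intro d hd
    rw [← smul_eq_C_mul]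
    refine MonomialOrder.degree_smul_le.trans ?_
    rw [(mon_eval u v e a b _ _ hu hv hu0 hv0).1]
    rcases (hW d hd).lt_or_eq with h | h
    · exact (smul_lt e he h).le
    · rw [h]
  · rw [coeff_sum, Finset.sum_filter]
    apply Finset.sum_congr rfl
    intro d hd
    rw [coeff_C_mul]
    split_ifs with h
    · rw [← h, (mon_eval u v e a b _ _ hu hv hu0 hv0).2]
    · rw [MonomialOrder.coeff_eq_zero_of_lt (m := ml) (f := u ^ d 0 * v ^ d 1), mul_zero]
      rw [(mon_eval u v e a b _ _ hu hv hu0 hv0).1]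
      exact smul_lt e he (lt_of_le_of_ne (hW d hd) h)

lemma jac_deg_iter (u v H : MvPolynomial (Fin 2) R) 
    (hv0 : v ≠ 0)
    (hj : jac u v ≠ 0) (hj0 : ml.degree (jac u v) = 0) (q : ℕ)
    (hq : aeval ![u, v] ((th 1)^[q] H) ≠ 0) :
    ml.toSyn (ml.degree (aeval ![u, v] ((th 1)^[q] H)) + q • (Finsupp.single 0 1 + Finsupp.single 1 1)) ≤
    ml.toSyn (q • (ml.degree u + ml.degree v) + ml.degree (aeval ![u, v] H)) := by
  have hbr : ml.degree (br u v) = Finsupp.single 0 1 + Finsupp.single 1 1 := by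
    rw [br_eq, MonomialOrder.degree_mul (mul_ne_zero (X_ne_zero _) (X_ne_zero _)) hj,
      MonomialOrder.degree_mul (X_ne_zero _) (X_ne_zero _), MonomialOrder.degree_X,
      MonomialOrder.degree_X, hj0, add_zero]
  have hbr0 : br u v ≠ 0 := by
    rw [br_eq]; exact mul_ne_zero (mul_ne_zero (X_ne_zero _) (X_ne_zero _)) hj
  induction q with
  | zero => simp
  | succ q ih =>
    rw [Function.iterate_succ_apply'] at hq ⊢
    have hc := br_chain u v ((th 1)^[q] H)
    have hq' : aeval ![u, v] ((th 1)^[q] H) ≠ 0 := by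
      intro h
      rw [h] at hc
      have : br u 0 = 0 := by simp [br, th]
      rw [this, mul_zero] at hc
      exact mul_ne_zero hq hbr0 hc.symm
    have ih := ih hq'
    have h1 : ml.toSyn (ml.degree (aeval ![u, v] (th 1 ((th 1)^[q] H)) * br u v)) ≤
       ml.toSyn (ml.degree v + (ml.degree u + ml.degree (aeval ![u, v] ((th 1)^[q] H)))) := by
      rw [← hc]
      exact deg_mul_le' _ _ _ _ le_rfl (deg_br_le _ _)
    rw [MonomialOrder.degree_mul hq hbr0, hbr] at h1
    simp only [map_add, succ_nsmul] at h1 ih ⊢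
    have := add_le_add h1 ih
    generalize ml.toSyn (ml.degree (aeval ![u, v] ((th 1)^[q] H))) = z at *
    rw [← add_le_add_iff_left z]
    convert this using 1
    · abel
    · abel

variable [CharZero R]

open Classical in
lemma exists_q (H : MvPolynomial (Fin 2) R) (α β : R) (hα : α ≠ 0) (hβ : β ≠ 0) (a b W : ℕ)
    (ha : 0 < a) (hb : 0 < b) (hab : Nat.Coprime a b)
    (h : ∃ d ∈ H.support, a * d 0 + b * d 1 = W) :
    ∃ q : ℕ, q * (a * b) ≤ W ∧
      ∑ d ∈ H.support with a * d 0 + b * d 1 = W, (d 1 : R) ^ q * coeff d H * (α ^ d 0 * β ^ d 1) ≠ 0 := by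
  obtain ⟨d₀, hd₀, hW₀⟩ := h
  by_contra hcon
  push Not at hcon
  set r := d₀ 1 % a with hr
  set N := W / (a * b) with hN
  have hpos : 0 < a * b := Nat.mul_pos ha hb
  -- for each d of weight W, d 1 = r + t a with t ≤ N
  have key : ∀ d ∈ H.support.filter (fun d => a * d 0 + b * d 1 = W),
      d 1 = r + (d 1 / a) * a ∧ d 1 / a ∈ Finset.range (N + 1) := by
    intro d hd
    have hdW := (Finset.mem_filter.1 hd).2
    constructor
    · have : d 1 % a = r := by
        rw [hr]
        have : b * d 1 ≡ b * d₀ 1 [MOD a] := by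
          have h1 : a * d 0 + b * d 1 ≡ a * d₀ 0 + b * d₀ 1 [MOD a] := by rw [hdW, hW₀]
          have h2 : a * d 0 + b * d 1 ≡ b * d 1 [MOD a] := by
            simp [Nat.ModEq]
          have h3 : a * d₀ 0 + b * d₀ 1 ≡ b * d₀ 1 [MOD a] := by
            simp [Nat.ModEq]
          exact h2.symm.trans (h1.trans h3)
        exact Nat.ModEq.cancel_left_of_coprime (by simpa using hab) this
      rw [← this, mul_comm]; exact (Nat.mod_add_div _ _).symm
    · rw [Finset.mem_range, Nat.lt_succ_iff, hN, Nat.le_div_iff_mul_le hpos]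
      have h1 : d 1 / a * a ≤ d 1 := Nat.div_mul_le_self _ _
      calc d 1 / a * (a * b) = b * (d 1 / a * a) := by ring
        _ ≤ b * d 1 := Nat.mul_le_mul_left _ h1
        _ ≤ W := by omega
  set c : ℕ → R := fun t => ∑ d ∈ (H.support.filter (fun d => a * d 0 + b * d 1 = W)) with d 1 / a = t,
     coeff d H * (α ^ d 0 * β ^ d 1) with hc
  have hsum : ∀ q, ∑ d ∈ H.support with a * d 0 + b * d 1 = W, (d 1 : R) ^ q * coeff d H * (α ^ d 0 * β ^ d 1)
      = ∑ t ∈ Finset.range (N + 1), c t * ((r + t * a : ℕ) : R) ^ q := by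
    intro q
    rw [← Finset.sum_fiberwise_of_maps_to (g := fun d => d 1 / a) (fun d hd => (key d hd).2)]
    apply Finset.sum_congr rfl
    intro t _
    rw [hc, Finset.sum_mul]
    apply Finset.sum_congr rfl
    intro d hd
    rw [Finset.mem_filter] at hd
    have h1 := (key d hd.1).1
    rw [hd.2] at h1
    rw [← h1]; ring
  have hz : (fun t : Fin (N + 1) => c t) = 0 := by
    apply Matrix.eq_zero_of_forall_pow_sum_mul_pow_eq_zero
      (f := fun t : Fin (N + 1) => ((r + t * a : ℕ) : R))
    · intro s t hst
      have : r + (s : ℕ) * a = r + t * a := by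
        have hst2 : ((r + (s : ℕ) * a : ℕ) : R) = ((r + (t : ℕ) * a : ℕ) : R) := hst
        exact Nat.cast_injective hst2
      have := Nat.eq_of_mul_eq_mul_right ha (by omega : (s : ℕ) * a = t * a)
      exact Fin.ext this
    · intro i
      rw [← hcon i, hsum, Finset.sum_range]
      have : (i : ℕ) ≤ N := by omega
      exact (Nat.mul_le_mul_right _ this).trans (Nat.div_mul_le_self _ _)
  have hmem : d₀ ∈ H.support.filter (fun d => a * d 0 + b * d 1 = W) :=
    Finset.mem_filter.2 ⟨hd₀, hW₀⟩
  have hlt := Finset.mem_range.1 (key d₀ hmem).2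
  have h0 : c (d₀ 1 / a) = 0 := congrFun hz ⟨_, hlt⟩
  have hsing : ((H.support.filter (fun d => a * d 0 + b * d 1 = W)).filter
      (fun d => d 1 / a = d₀ 1 / a)) = {d₀} := by
    ext d
    simp only [Finset.mem_filter, Finset.mem_singleton]
    constructor
    · rintro ⟨hd, ht⟩
      have hd' : d ∈ H.support.filter (fun d => a * d 0 + b * d 1 = W) := Finset.mem_filter.2 hd
      have h1 : d 1 = d₀ 1 := by
        rw [(key d hd').1, (key d₀ hmem).1, ht]
      have h2 : d 0 = d₀ 0 := by
        have := hd.2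
        rw [h1, ← hW₀] at this
        exact Nat.eq_of_mul_eq_mul_left ha (by omega)
      ext i; fin_cases i
      · exact h2
      · exact h1
    · rintro rfl
      exact ⟨⟨hd₀, hW₀⟩, rfl⟩
  rw [hc] at h0
  simp only [hsing, Finset.sum_singleton] at h0
  exact mul_ne_zero (mem_support_iff.1 hd₀) (mul_ne_zero (pow_ne_zero _ hα) (pow_ne_zero _ hβ)) h0

lemma key_deg (u v : MvPolynomial (Fin 2) R) (e : Fin 2 →₀ ℕ) (he : e ≠ 0) (a b : ℕ)
    (ha : 2 ≤ a) (hb : 2 ≤ b) (hab : Nat.Coprime a b)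
    (hu : ml.degree u = a • e) (hv : ml.degree v = b • e)
    (hj : jac u v ≠ 0) (hj0 : ml.degree (jac u v) = 0)
    (H : MvPolynomial (Fin 2) R) (hH : aeval ![u, v] H ≠ 0) :
    (∃ W : ℕ, ml.degree (aeval ![u, v] H) = W • e) ∨
    ∃ q : ℕ, 1 ≤ q ∧ ml.toSyn (q • (Finsupp.single 0 1 + Finsupp.single 1 1)) ≤
      ml.toSyn (ml.degree (aeval ![u, v] H)) := by
  classical
  have hu0 : u ≠ 0 := by rintro rfl; simp [jac] at hj
  have hv0 : v ≠ 0 := by rintro rfl; simp [jac] at hj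
  have hH0 : H.support.Nonempty := by
    rw [Finset.nonempty_iff_ne_empty, Ne, support_eq_empty]
    rintro rfl; simp at hH
  obtain ⟨d₀, hd₀, hmax⟩ := Finset.exists_max_image H.support (fun d => a * d 0 + b * d 1) hH0
  set W := a * d₀ 0 + b * d₀ 1 with hW
  obtain ⟨q, hq, hne⟩ := exists_q H (ml.leadingCoeff u) (ml.leadingCoeff v)
    (MonomialOrder.leadingCoeff_ne_zero_iff.2 hu0) (MonomialOrder.leadingCoeff_ne_zero_iff.2 hv0)
    a b W (by omega) (by omega) hab ⟨d₀, hd₀, rfl⟩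
  have hsupp : ((th 1)^[q] H).support ⊆ H.support := by
    intro d hd
    rw [mem_support_iff, coeff_th_iter] at hd
    rw [mem_support_iff]
    intro h; exact hd (by rw [h, mul_zero])
  have htop := (top_coeff u v ((th 1)^[q] H) e he a b W hu hv hu0 hv0 _ hsupp hmax).2
  simp only [coeff_th_iter] at htop
  rw [← htop] at hne
  have hle : ml.toSyn (W • e) ≤ ml.toSyn (ml.degree (aeval ![u, v] ((th 1)^[q] H))) :=
    MonomialOrder.le_degree (mem_support_iff.2 hne)
  rcases Nat.eq_zero_or_pos q with rfl | hq1
  · left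
    refine ⟨W, ?_⟩
    apply ml.toSyn.injective
    exact le_antisymm (top_coeff u v H e he a b W hu hv hu0 hv0 _ subset_rfl hmax).1 hle
  · right
    refine ⟨q, hq1, ?_⟩
    have h1 := jac_deg_iter u v H hv0 hj hj0 q (by rintro h; rw [h] at hne; simp at hne)
    rw [map_add, map_add] at h1
    have h2 := (add_le_add_left hle _).trans h1
    have h3 : ml.toSyn (q • (ml.degree u + ml.degree v)) ≤ ml.toSyn (W • e) := by
      rw [hu, hv, ← add_smul, smul_smul]
      apply ml.toSyn_monotone
      have : q * (a + b) ≤ W := by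
        refine le_trans (Nat.mul_le_mul_left _ ?_) hq
        nlinarith
      intro i
      simp only [Finsupp.smul_apply, smul_eq_mul]
      exact Nat.mul_le_mul_right _ this
    have h4 := h2.trans (add_le_add_left h3 _)
    exact le_of_add_le_add_left h4

end domain
end RealForm

set_option linter.unusedSectionVars false
open MvPolynomial

namespace RealForm

section sat
variable {R : Type*} [CommRing R] {A : Type*} [CommRing A] [Algebra R A]

/-- the subalgebra generated by two elements -/
noncomputable def gen (R : Type*) [CommRing R] {A : Type*} [CommRing A] [Algebra R A] (u v : A) :
    Subalgebra R A := (aeval ![u, v] : MvPolynomial (Fin 2) R →ₐ[R] A).range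

lemma mem_gen {u v f : A} : f ∈ gen R u v ↔ ∃ H : MvPolynomial (Fin 2) R, aeval ![u, v] H = f :=
  Iff.rfl

lemma gen_eq_adjoin (u v : A) : gen R u v = Algebra.adjoin R {u, v} := by
  rw [gen, ← Algebra.adjoin_range_eq_range_aeval]
  congr 1
  simp [Matrix.range_cons, Set.pair_comm]

lemma left_mem_gen (u v : A) : u ∈ gen R u v := ⟨X 0, by simp⟩
lemma right_mem_gen (u v : A) : v ∈ gen R u v := ⟨X 1, by simp⟩

lemma gen_le {u v : A} {T : Subalgebra R A} (hu : u ∈ T) (hv : v ∈ T) : gen R u v ≤ T := by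
  rw [gen_eq_adjoin]
  apply Algebra.adjoin_le
  rintro x (rfl | rfl) <;> assumption

lemma gen_swap (u v : A) : gen R u v = gen R v u :=
  le_antisymm (gen_le (right_mem_gen _ _) (left_mem_gen _ _))
    (gen_le (right_mem_gen _ _) (left_mem_gen _ _))

variable [IsDomain R]

/-- elements having a nonzero multiple in `T` -/
def sat (T : Subalgebra R A) : Subalgebra R A where
  carrier := {f | ∃ d : R, d ≠ 0 ∧ d • f ∈ T}
  mul_mem' := by
    rintro f g ⟨d, hd, hf⟩ ⟨d', hd', hg⟩
    refine ⟨d * d', mul_ne_zero hd hd', ?_⟩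
    have := T.mul_mem hf hg
    rwa [smul_mul_smul_comm] at this
  add_mem' := by
    rintro f g ⟨d, hd, hf⟩ ⟨d', hd', hg⟩
    refine ⟨d * d', mul_ne_zero hd hd', ?_⟩
    have := T.add_mem (T.smul_mem hf d') (T.smul_mem hg d)
    rwa [smul_smul, smul_smul, mul_comm d' d, ← smul_add] at this
  algebraMap_mem' := fun r => ⟨1, one_ne_zero, by
    rw [one_smul]; exact T.algebraMap_mem r⟩

lemma mem_sat {T : Subalgebra R A} {f : A} : f ∈ sat T ↔ ∃ d : R, d ≠ 0 ∧ d • f ∈ T := Iff.rfl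

lemma le_sat (T : Subalgebra R A) : T ≤ sat T := fun f hf => ⟨1, one_ne_zero, by rwa [one_smul]⟩

lemma sat_le_sat {T S : Subalgebra R A} (h : T ≤ sat S) : sat T ≤ sat S := by
  rintro f ⟨d, hd, hf⟩
  obtain ⟨d', hd', hf'⟩ := h hf
  exact ⟨d' * d, mul_ne_zero hd' hd, by rwa [mul_smul]⟩

lemma mem_sat_of_smul {S : Subalgebra R A} {d : R} (hd : d ≠ 0) {f : A} (h : d • f ∈ sat S) :
    f ∈ sat S := by
  obtain ⟨d', hd', hf'⟩ := h
  exact ⟨d' * d, mul_ne_zero hd' hd, by rwa [mul_smul]⟩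

/-- generically generating pair -/
def GP (u v : MvPolynomial (Fin 2) R) : Prop := sat (gen R u v) = ⊤

lemma top_of_X {T : Subalgebra R (MvPolynomial (Fin 2) R)} (h0 : X 0 ∈ T) (h1 : X 1 ∈ T) : T = ⊤ := by
  rw [eq_top_iff, ← MvPolynomial.adjoin_range_X]
  apply Algebra.adjoin_le
  rintro _ ⟨i, rfl⟩
  fin_cases i
  · exact h0
  · exact h1

lemma GP_of_mem {u v u' v' : MvPolynomial (Fin 2) R} (h : GP u v) (hu : u ∈ sat (gen R u' v'))
    (hv : v ∈ sat (gen R u' v')) : GP u' v' := by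
  rw [GP, eq_top_iff, ← h]
  exact sat_le_sat (gen_le hu hv)

lemma GP_swap {u v : MvPolynomial (Fin 2) R} (h : GP u v) : GP v u := by
  rw [GP, gen_swap]; exact h

lemma GP_exists {u v : MvPolynomial (Fin 2) R} (h : GP u v) (i : Fin 2) :
    ∃ d : R, d ≠ 0 ∧ ∃ H : MvPolynomial (Fin 2) R, aeval ![u, v] H = C d * X i := by
  have : X i ∈ sat (gen R u v) := by rw [h]; trivial
  obtain ⟨d, hd, H, hH⟩ := this
  exact ⟨d, hd, H, by rw [← smul_eq_C_mul]; exact hH⟩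

lemma GP_step {u v : MvPolynomial (Fin 2) R} (h : GP u v) {a b : R} (hb : b ≠ 0) (k : ℕ) :
    GP (C b * u + C a * v ^ k) v := by
  have hv := right_mem_gen (R := R) (C b * u + C a * v ^ k) v
  refine GP_of_mem h (mem_sat.2 ⟨b, hb, ?_⟩) (le_sat _ hv)
  have := Subalgebra.sub_mem _ (left_mem_gen (R := R) (C b * u + C a * v ^ k) v)
    (Subalgebra.smul_mem _ (Subalgebra.pow_mem _ hv k) a)
  rw [smul_eq_C_mul] at this ⊢
  simpa using this

lemma GP_jac {u v : MvPolynomial (Fin 2) R} (h : GP u v) :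
    ∃ d : R, d ≠ 0 ∧ jac u v ∣ C d := by
  obtain ⟨d, hd, F, hF⟩ := GP_exists h 0
  obtain ⟨d', hd', G, hG⟩ := GP_exists h 1
  refine ⟨d * d', mul_ne_zero hd hd', aeval ![u, v] (jac F G), ?_⟩
  have := jac_aeval ![u, v] F G
  rw [hF, hG] at this
  simp only [Matrix.cons_val_zero, Matrix.cons_val_one] at this
  rw [mul_comm (jac u v), ← this]
  simp [jac, pderiv_X, Pi.single_apply]

lemma GP_jac_ne {u v : MvPolynomial (Fin 2) R} (h : GP u v) : jac u v ≠ 0 := by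
  obtain ⟨d, hd, h1⟩ := GP_jac h
  intro h0
  rw [h0, zero_dvd_iff] at h1
  exact hd (by simpa using h1)

lemma GP_jac_deg {u v : MvPolynomial (Fin 2) R} (h : GP u v) : ml.degree (jac u v) = 0 := by
  obtain ⟨d, hd, g, h1⟩ := GP_jac h
  have hg : g ≠ 0 := by
    rintro rfl
    rw [mul_zero] at h1
    exact hd (by simpa using h1)
  have := congrArg ml.degree h1
  rw [MonomialOrder.degree_mul (GP_jac_ne h) hg, MonomialOrder.degree_C] at this
  exact (add_eq_zero.1 this.symm).1

lemma deg_ne_zero {u v : MvPolynomial (Fin 2) R} (h : jac u v ≠ 0) : ml.degree u ≠ 0 := by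
  intro h0
  have := MonomialOrder.eq_C_of_degree_eq_zero h0
  apply h
  rw [this]
  simp [jac]

lemma jac_swap (u v : MvPolynomial (Fin 2) R) : jac v u = - jac u v := by
  simp [jac]; ring

lemma prop_exists (n m : Fin 2 →₀ ℕ) (hn : n ≠ 0) (hm : m ≠ 0) (h : n 0 * m 1 = n 1 * m 0) :
    ∃ (e : Fin 2 →₀ ℕ) (a b : ℕ), e ≠ 0 ∧ 1 ≤ a ∧ 1 ≤ b ∧ Nat.Coprime a b ∧ n = a • e ∧ m = b • e := by
  have hz : ∀ x : Fin 2 →₀ ℕ, x ≠ 0 → x 0 = 0 → x 1 ≠ 0 := by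
    intro x hx h0 h1
    apply hx; ext i; fin_cases i <;> simp [h0, h1]
  suffices ∃ (e : Fin 2 →₀ ℕ) (a b : ℕ), Nat.Coprime a b ∧ n = a • e ∧ m = b • e by
    obtain ⟨e, a, b, hab, h1, h2⟩ := this
    refine ⟨e, a, b, ?_, ?_, ?_, hab, h1, h2⟩
    · rintro rfl; exact hn (by simpa using h1)
    · rcases Nat.eq_zero_or_pos a with rfl | h
      · exact absurd (by simpa using h1) hn
      · exact h
    · rcases Nat.eq_zero_or_pos b with rfl | h
      · exact absurd (by simpa using h2) hm
      · exact h
  by_cases h0 : n 0 = 0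
  · have h1 := hz n hn h0
    have hm0 : m 0 = 0 := by
      rw [h0, zero_mul] at h
      exact (mul_eq_zero.1 h.symm).resolve_left h1
    have hg : 0 < Nat.gcd (n 1) (m 1) := Nat.gcd_pos_of_pos_left _ (Nat.pos_of_ne_zero h1)
    refine ⟨Finsupp.single 1 (Nat.gcd (n 1) (m 1)), _, _, Nat.coprime_div_gcd_div_gcd hg, ?_, ?_⟩
    · ext i; fin_cases i
      · simp [h0]
      · simp [Nat.div_mul_cancel (Nat.gcd_dvd_left _ _)]
    · ext i; fin_cases i
      · simp [hm0]
      · simp [Nat.div_mul_cancel (Nat.gcd_dvd_right _ _)]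
  · have hg : 0 < Nat.gcd (n 0) (m 0) := Nat.gcd_pos_of_pos_left _ (Nat.pos_of_ne_zero h0)
    have hco := Nat.coprime_div_gcd_div_gcd hg
    set g := Nat.gcd (n 0) (m 0)
    obtain ⟨a, ha⟩ : g ∣ n 0 := Nat.gcd_dvd_left _ _
    obtain ⟨b, hb⟩ : g ∣ m 0 := Nat.gcd_dvd_right _ _
    rw [ha, hb, Nat.mul_div_cancel_left _ hg, Nat.mul_div_cancel_left _ hg] at hco
    rw [ha, hb] at h
    have h' : a * m 1 = n 1 * b := Nat.eq_of_mul_eq_mul_left hg (by linarith)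
    obtain ⟨c, hc⟩ : a ∣ n 1 := hco.dvd_of_dvd_mul_right ⟨_, h'.symm⟩
    have ha0 : 0 < a := Nat.pos_of_ne_zero (by rintro rfl; exact h0 (by simpa using ha))
    have hm1 : m 1 = b * c := by
      rw [hc, mul_assoc] at h'
      have := Nat.eq_of_mul_eq_mul_left ha0 h'
      rw [this, mul_comm]
    refine ⟨Finsupp.single 0 g + Finsupp.single 1 c, a, b, hco, ?_, ?_⟩
    · ext i; fin_cases i
      · simp [ha, mul_comm]
      · simp [hc]
    · ext i; fin_cases i
      · simp [hb, mul_comm]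
      · simp [hm1]

lemma deg_CX {d : R} (hd : d ≠ 0) (i : Fin 2) :
    ml.degree (C d * X i : MvPolynomial (Fin 2) R) = Finsupp.single i 1 := by
  rw [MonomialOrder.degree_mul (by simpa using hd) (X_ne_zero _), MonomialOrder.degree_C,
    MonomialOrder.degree_X, zero_add]

variable [CharZero R]

lemma jung_dich {u v : MvPolynomial (Fin 2) R} (h : GP u v) :
    (ml.degree u = Finsupp.single 0 1 ∧ ml.degree v = Finsupp.single 1 1) ∨
    (ml.degree v = Finsupp.single 0 1 ∧ ml.degree u = Finsupp.single 1 1) ∨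
    (∃ k : ℕ, ml.degree u = k • ml.degree v) ∨ (∃ k : ℕ, ml.degree v = k • ml.degree u) := by
  have hj := GP_jac_ne h
  have hj0 := GP_jac_deg h
  have hn := deg_ne_zero hj
  have hm : ml.degree v ≠ 0 := deg_ne_zero (GP_jac_ne (GP_swap h))
  have hu0 : u ≠ 0 := by rintro rfl; simp [jac] at hj
  have hv0 : v ≠ 0 := by rintro rfl; simp [jac] at hj
  have hbr : ml.degree (br u v) = Finsupp.single 0 1 + Finsupp.single 1 1 := by
    rw [br_eq, MonomialOrder.degree_mul (mul_ne_zero (X_ne_zero _) (X_ne_zero _)) hj,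
      MonomialOrder.degree_mul (X_ne_zero _) (X_ne_zero _), MonomialOrder.degree_X,
      MonomialOrder.degree_X, hj0, add_zero]
  by_cases hdet : ml.degree u 0 * ml.degree v 1 = ml.degree u 1 * ml.degree v 0
  · right; right
    obtain ⟨e, a, b, he, ha, hb, hab, hu, hv⟩ := prop_exists _ _ hn hm hdet
    rcases Nat.lt_or_ge a 2 with ha2 | ha2
    · obtain rfl : a = 1 := by omega
      right; refine ⟨b, ?_⟩
      rw [hv, hu, one_smul]
    rcases Nat.lt_or_ge b 2 with hb2 | hb2
    · obtain rfl : b = 1 := by omega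
      left; refine ⟨a, ?_⟩
      rw [hv, hu, one_smul]
    exfalso
    have H : ∀ i : Fin 2, ∃ W : ℕ, Finsupp.single i 1 = W • e := by
      intro i
      obtain ⟨d, hd, H, hH⟩ := GP_exists h i
      have := key_deg u v e he a b ha2 hb2 hab hu hv hj hj0 H
        (by rw [hH]; exact mul_ne_zero (by simpa using hd) (X_ne_zero _))
      rw [hH, deg_CX hd] at this
      rcases this with h1 | ⟨q, hq, h1⟩
      · exact h1
      · exfalso
        rw [le2] at h1
        fin_cases i
        · simp at h1; omega
        · simp at h1; omega
    obtain ⟨W, hW⟩ := H 0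
    obtain ⟨W', hW'⟩ := H 1
    have h1 := DFunLike.congr_fun hW 0
    have h2 := DFunLike.congr_fun hW 1
    have h3 := DFunLike.congr_fun hW' 0
    have h4 := DFunLike.congr_fun hW' 1
    simp at h1 h2 h3 h4
    rcases h2 with h2 | h2
    · simp [h2] at h1
    · rw [h2] at h4; simp at h4
  · have hco := coeff_br u v
    have hne : coeff (ml.degree u + ml.degree v) (br u v) ≠ 0 := by
      rw [hco]
      refine mul_ne_zero ?_ (mul_ne_zero (MonomialOrder.leadingCoeff_ne_zero_iff.2 hu0)
        (MonomialOrder.leadingCoeff_ne_zero_iff.2 hv0))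
      rw [sub_ne_zero]
      exact_mod_cast hdet
    have h1 : ml.toSyn (ml.degree u + ml.degree v) ≤ ml.toSyn (ml.degree (br u v)) :=
      MonomialOrder.le_degree (mem_support_iff.2 hne)
    have h2 := ml.toSyn.injective (le_antisymm h1 (deg_br_le u v))
    rw [hbr] at h2
    have h3 := DFunLike.congr_fun h2 0
    have h4 := DFunLike.congr_fun h2 1
    simp at h3 h4
    generalize ml.degree u = n at *
    generalize ml.degree v = m at *
    have : n 0 = 0 ∨ n 0 = 1 := by omega
    have : n 1 = 0 ∨ n 1 = 1 := by omega
    have : (n 0 = 1 ∧ n 1 = 0 ∧ m 0 = 0 ∧ m 1 = 1) ∨ (m 0 = 1 ∧ m 1 = 0 ∧ n 0 = 0 ∧ n 1 = 1) := by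
      rcases ‹n 0 = 0 ∨ n 0 = 1› with h | h <;> rcases ‹n 1 = 0 ∨ n 1 = 1› with h' | h'
      · exact absurd (by rw [h, h']; simp) hdet
      · right; omega
      · left; omega
      · have hh : m 0 = 0 := by omega
        have hh' : m 1 = 0 := by omega
        exact absurd (by rw [hh, hh']; simp) hdet
    rcases this with h | h
    · left
      constructor <;> (ext i; fin_cases i <;> simp [h])
    · right; left
      constructor <;> (ext i; fin_cases i <;> simp [h])

lemma of_deg_y (u : MvPolynomial (Fin 2) R) (h : ∀ d ∈ u.support, d 0 = 0) :
    ∃ p : Polynomial R, u = Polynomial.aeval (X 1) p := by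
  refine ⟨∑ d ∈ u.support, Polynomial.monomial (d 1) (coeff d u), ?_⟩
  rw [map_sum]
  conv_lhs => rw [u.as_sum]
  apply Finset.sum_congr rfl
  intro d hd
  rw [Polynomial.aeval_monomial, monomial_eq, algebraMap_eq, Finsupp.prod_fintype _ _ (by simp),
    Fin.prod_univ_two, h d hd]
  simp

lemma base_form {u v : MvPolynomial (Fin 2) R}
    (hu : ml.degree u = Finsupp.single 0 1) (hv : ml.degree v = Finsupp.single 1 1) :
    ∃ (a b c : R) (p : Polynomial R), a ≠ 0 ∧ b ≠ 0 ∧ u = C a * X 0 + Polynomial.aeval (X 1) p ∧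
      v = C b * X 1 + C c := by
  have hu0 : u ≠ 0 := by rintro rfl; simp at hu; simpa using DFunLike.congr_fun hu 0
  have hv0 : v ≠ 0 := by rintro rfl; simp at hv; simpa using DFunLike.congr_fun hv 1
  have h1 : ∀ d ∈ (u - C (ml.leadingCoeff u) * X 0).support, d 0 = 0 := by
    intro d hd
    rw [mem_support_iff, coeff_sub, coeff_C_mul, coeff_X'] at hd
    by_cases hdd : d = Finsupp.single 0 1
    · subst hdd
      simp [MonomialOrder.leadingCoeff, hu] at hd
    · rw [if_neg (Ne.symm hdd)] at hd
      simp at hd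
      have := MonomialOrder.le_degree (m := ml) (mem_support_iff.2 hd)
      rw [hu, le2] at this
      simp at this
      rcases this with h | h
      · exact h
      · exfalso; apply hdd; ext i; fin_cases i <;> simp [h]
  obtain ⟨p, hp⟩ := of_deg_y _ h1
  refine ⟨ml.leadingCoeff u, ml.leadingCoeff v, coeff 0 v, p,
    MonomialOrder.leadingCoeff_ne_zero_iff.2 hu0, MonomialOrder.leadingCoeff_ne_zero_iff.2 hv0, ?_, ?_⟩
  · rw [← hp]; ring
  · ext d
    rw [coeff_add, coeff_C_mul, coeff_X', coeff_C]
    by_cases hd1 : d = Finsupp.single 1 1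
    · subst hd1
      simp [MonomialOrder.leadingCoeff, hv]
      intro h; simpa using DFunLike.congr_fun h 1
    · rw [if_neg (Ne.symm hd1)]
      by_cases hd0 : d = 0
      · simp [hd0]
      · rw [if_neg (Ne.symm hd0)]
        simp
        by_contra hc
        have := MonomialOrder.le_degree (m := ml) (mem_support_iff.2 hc)
        rw [hv, le2] at this
        simp at this
        have h1 : d 1 = 0 ∨ d 1 = 1 := by omega
        rcases h1 with h1 | h1
        · apply hd0; ext i; fin_cases i <;> simp [h1, this.1]
        · apply hd1; ext i; fin_cases i <;> simp [h1, this.1]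

lemma deg_drop {u v : MvPolynomial (Fin 2) R} {k : ℕ} (h : ml.degree u = k • ml.degree v)
    (hu : ml.degree u ≠ 0) :
    ml.toSyn (ml.degree (C (ml.leadingCoeff v ^ k) * u + C (- ml.leadingCoeff u) * v ^ k)) <
      ml.toSyn (ml.degree u) := by
  have hle : ml.toSyn (ml.degree (C (ml.leadingCoeff v ^ k) * u + C (- ml.leadingCoeff u) * v ^ k)) ≤
      ml.toSyn (ml.degree u) := by
    refine MonomialOrder.degree_add_le.trans (sup_le ?_ ?_)
    · rw [← smul_eq_C_mul]; exact MonomialOrder.degree_smul_le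
    · rw [← smul_eq_C_mul]; refine MonomialOrder.degree_smul_le.trans ?_
      rw [MonomialOrder.degree_pow, h]
  refine lt_of_le_of_ne hle ?_
  intro heq
  have heq := ml.toSyn.injective heq
  have hc : coeff (ml.degree u) (C (ml.leadingCoeff v ^ k) * u + C (- ml.leadingCoeff u) * v ^ k) = 0 := by
    rw [coeff_add, coeff_C_mul, coeff_C_mul]
    have : coeff (ml.degree u) (v ^ k) = ml.leadingCoeff v ^ k := by
      rw [← MonomialOrder.leadingCoeff_pow, MonomialOrder.leadingCoeff, MonomialOrder.degree_pow, h]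
    have h2 : coeff (ml.degree u) u = ml.leadingCoeff u := rfl
    rw [this, h2]; ring
  have hne : C (ml.leadingCoeff v ^ k) * u + C (- ml.leadingCoeff u) * v ^ k ≠ 0 := by
    intro h0
    rw [h0] at heq
    exact hu (by rw [← heq]; simp)
  rw [← heq] at hc
  exact MonomialOrder.leadingCoeff_ne_zero_iff.2 hne hc

theorem jungInd (P : MvPolynomial (Fin 2) R → MvPolynomial (Fin 2) R → Prop)
    (base : ∀ (a b c : R) (p : Polynomial R), a ≠ 0 → b ≠ 0 →
      P (C a * X 0 + Polynomial.aeval (X 1) p) (C b * X 1 + C c))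
    (swap : ∀ u v, GP u v → P u v → P v u)
    (step : ∀ u v (a b : R) (k : ℕ), b ≠ 0 → GP u v → GP (C b * u + C a * v ^ k) v →
      P (C b * u + C a * v ^ k) v → P u v) : ∀ u v, GP u v → P u v := by
  suffices ∀ (s : ml.syn) (u v : MvPolynomial (Fin 2) R),
      ml.toSyn (ml.degree u) + ml.toSyn (ml.degree v) = s → GP u v → P u v from
    fun u v h => this _ u v rfl h
  intro s
  induction s using WellFoundedLT.induction with
  | ind s ih =>
    have main : ∀ u v, ml.toSyn (ml.degree u) + ml.toSyn (ml.degree v) = s → GP u v →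
        (∃ k : ℕ, ml.degree u = k • ml.degree v) → P u v := by
      rintro u v hs h ⟨k, hk⟩
      have hj := GP_jac_ne h
      have hv0 : v ≠ 0 := by rintro rfl; simp [jac] at hj
      have hb : ml.leadingCoeff v ^ k ≠ 0 :=
        pow_ne_zero _ (MonomialOrder.leadingCoeff_ne_zero_iff.2 hv0)
      have hg := GP_step h (a := - ml.leadingCoeff u) hb k
      refine step u v _ _ k hb h hg (ih _ ?_ _ _ rfl hg)
      rw [← hs]
      exact add_lt_add_left (deg_drop hk (deg_ne_zero hj)) _
    intro u v hs h
    rcases jung_dich h with h1 | h1 | h1 | h1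
    · obtain ⟨a, b, c, p, ha, hb, rfl, rfl⟩ := base_form h1.1 h1.2
      exact base a b c p ha hb
    · obtain ⟨a, b, c, p, ha, hb, rfl, rfl⟩ := base_form h1.1 h1.2
      exact swap _ _ (GP_swap h) (base a b c p ha hb)
    · exact main u v hs h h1
    · exact swap _ _ (GP_swap h) (main v u (by rw [add_comm]; exact hs) (GP_swap h) h1)

end sat
end RealForm

set_option linter.unusedSectionVars false
open MvPolynomial

namespace RealForm

section kamb
variable {G : Type*} [Group G]

def alt (A T : G → Prop) (g h : G) : Prop := (A g ∧ ¬ T g ∧ T h ∧ ¬ A h) ∨ (T g ∧ ¬ A g ∧ A h ∧ ¬ T h)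

lemma chain_or {α : Type*} (r : α → α → Prop) (l : List α) :
    l.IsChain r ∨ ∃ l1 g h l2, l = l1 ++ g :: h :: l2 ∧ ¬ r g h := by
  induction l with
  | nil => left; exact List.IsChain.nil
  | cons a l ih =>
    rcases ih with ih | ⟨l1, g, h, l2, rfl, hr⟩
    · cases l with
      | nil => left; exact List.IsChain.singleton _
      | cons b l =>
        by_cases hab : r a b
        · left; exact List.IsChain.cons_cons hab ih
        · right; exact ⟨[], a, b, l, rfl, hab⟩
    · right; exact ⟨a :: l1, g, h, l2, rfl, hr⟩

lemma kamb (bar : G →* G) (A T : G → Prop) (hA1 : A 1)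
    (hA : ∀ g h, A g → A h → A (g * h)) (hT : ∀ g h, T g → T h → T (g * h))
    (hAb : ∀ g, A g → A (bar g)) (hTb : ∀ g, T g → T (bar g)) (hbb : ∀ g, bar (bar g) = g)
    (N : ∀ l : List G, 2 ≤ l.length → l.IsChain (alt A T) → l.prod ≠ 1) (n : ℕ) :
    ∀ (l : List G), l.length = n → (∀ h ∈ l, A h ∨ T h) → l.prod * bar l.prod = 1 →
      ∃ g, A (g⁻¹ * l.prod * bar g) ∨ T (g⁻¹ * l.prod * bar g) := by
  have hAb' : ∀ g, A (bar g) ↔ A g := fun g => ⟨fun h => by simpa [hbb] using hAb _ h, hAb g⟩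
  have hTb' : ∀ g, T (bar g) ↔ T g := fun g => ⟨fun h => by simpa [hbb] using hTb _ h, hTb g⟩
  induction n with
  | zero =>
    intro l hl _ _
    rw [List.length_eq_zero_iff] at hl
    subst hl
    exact ⟨1, by simp [hA1]⟩
  | succ n ih =>
    intro l hl hmem hc
    rcases chain_or (alt A T) l with hch | ⟨l1, g, h, l2, rfl, hr⟩
    · -- reduced
      rcases Nat.eq_zero_or_pos n with rfl | hn
      · obtain ⟨a, rfl⟩ := List.length_eq_one_iff.1 hl
        refine ⟨1, ?_⟩
        have := hmem a (by simp)
        simpa using this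
      · obtain ⟨g, l', rfl⟩ : ∃ g l', l = g :: l' := by
          cases l with
          | nil => simp at hl
          | cons g l' => exact ⟨g, l', rfl⟩
        have hl' : l' ≠ [] := by rintro rfl; simp at hl; omega
        obtain ⟨m, h, rfl⟩ : ∃ m h, l' = m ++ [h] := ⟨_, _, (List.dropLast_append_getLast hl').symm⟩
        -- bar h and g not alternating
        have hnot : ¬ alt A T (bar h) g := by
          intro halt
          have hch2 : ((g :: (m ++ [h])).map bar ++ (g :: (m ++ [h]))).IsChain (alt A T) := by
            rw [List.isChain_append]
            refine ⟨?_, hch, ?_⟩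
            · rw [List.isChain_map]
              refine hch.imp ?_
              intro a b hab
              simpa [alt, hAb', hTb'] using hab
            · intro x hx y hy
              simp at hx hy
              rw [← List.cons_append, List.getLast?_append] at hx
              simp at hx
              subst hx; subst hy; exact halt
          refine N _ ?_ hch2 ?_
          · simp; omega
          · rw [List.prod_append, ← map_list_prod]
            have := congrArg bar hc
            rw [map_mul, hbb, map_one] at this
            exact this
        have hg := hmem g (by simp)
        have hh := hmem h (by simp)
        -- new list
        have hAT : (A (h * bar g)) ∨ T (h * bar g) := by
          by_contra hcon
          push Not at hcon
          apply hnot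
          rw [alt, hAb', hTb']
          have h1 : ¬ (A h ∧ A g) := fun x => hcon.1 (hA _ _ x.1 (hAb _ x.2))
          have h2 : ¬ (T h ∧ T g) := fun x => hcon.2 (hT _ _ x.1 (hTb _ x.2))
          tauto
        have hp : (m ++ [h * bar g]).prod = g⁻¹ * (g :: (m ++ [h])).prod * bar g := by
          simp [mul_assoc]
        obtain ⟨k, hk⟩ := ih (m ++ [h * bar g]) (by simp at hl ⊢; omega)
          (by
            intro x hx
            simp at hx
            rcases hx with hx | rfl
            · exact hmem x (by simp [hx])
            · exact hAT)
          (by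
            rw [hp]
            simp only [map_mul, map_inv, hbb]
            calc g⁻¹ * (g :: (m ++ [h])).prod * bar g * ((bar g)⁻¹ * bar (g :: (m ++ [h])).prod * g)
                = g⁻¹ * ((g :: (m ++ [h])).prod * bar (g :: (m ++ [h])).prod) * g := by group
              _ = 1 := by rw [hc]; group)
        refine ⟨g * k, ?_⟩
        rw [hp] at hk
        have : (g * k)⁻¹ * (g :: (m ++ [h])).prod * bar (g * k) =
          k⁻¹ * (g⁻¹ * (g :: (m ++ [h])).prod * bar g) * bar k := by
          rw [map_mul]; group
        rw [this]; exact hk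
    · have hg := hmem g (by simp)
      have hh := hmem h (by simp)
      have hAT : A (g * h) ∨ T (g * h) := by
        by_contra hcon
        push Not at hcon
        apply hr
        rw [alt]
        have h1 : ¬ (A g ∧ A h) := fun x => hcon.1 (hA _ _ x.1 x.2)
        have h2 : ¬ (T g ∧ T h) := fun x => hcon.2 (hT _ _ x.1 x.2)
        tauto
      have hp : (l1 ++ (g * h) :: l2).prod = (l1 ++ g :: h :: l2).prod := by simp [mul_assoc]
      rw [← hp]
      rw [← hp] at hc
      refine ih _ (by simp at hl ⊢; omega) ?_ hc
      intro x hx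
      simp at hx
      rcases hx with hx | rfl | hx
      · exact hmem x (by simp [hx])
      · exact hAT
      · exact hmem x (by simp [hx])
end kamb

end RealForm

set_option linter.unusedSectionVars false
open MvPolynomial

namespace RealForm

section fld
variable {K : Type*} [Field K]

local notation "B" => MvPolynomial (Fin 2) K

lemma deg_aeval_le (f : B) (p : Polynomial K) :
    (Polynomial.aeval f p).totalDegree ≤ p.natDegree * f.totalDegree := by
  rw [Polynomial.aeval_eq_sum_range]
  refine (totalDegree_finset_sum _ _).trans (Finset.sup_le ?_)
  intro i hi
  refine (totalDegree_smul_le _ _).trans ((totalDegree_pow _ _).trans ?_)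
  exact Nat.mul_le_mul_right _ (by simp at hi; omega)

lemma deg_aeval_eq (f : B) (hf : 1 ≤ f.totalDegree) (p : Polynomial K) (hp : 1 ≤ p.natDegree) :
    (Polynomial.aeval f p).totalDegree = p.natDegree * f.totalDegree := by
  have hf0 : f ≠ 0 := by rintro rfl; simp at hf
  have hp0 : p ≠ 0 := by rintro rfl; simp at hp
  conv_lhs => rw [← p.eraseLead_add_monomial_natDegree_leadingCoeff]
  have h1 : (Polynomial.aeval f (Polynomial.monomial p.natDegree p.leadingCoeff)).totalDegree =
      p.natDegree * f.totalDegree := by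
    rw [Polynomial.aeval_monomial, algebraMap_eq, totalDegree_mul_of_isDomain
      (by simpa using hp0) (pow_ne_zero _ hf0), totalDegree_C, zero_add]
    generalize p.natDegree = n
    induction n with
    | zero => simp
    | succ n ih => rw [pow_succ, totalDegree_mul_of_isDomain (pow_ne_zero _ hf0) hf0, ih]; ring
  have h2 : (Polynomial.aeval f p.eraseLead).totalDegree <
     (Polynomial.aeval f (Polynomial.monomial p.natDegree p.leadingCoeff)).totalDegree := by
    rw [h1]
    refine (deg_aeval_le _ _).trans_lt ?_
    apply Nat.mul_lt_mul_of_pos_right _ hf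
    have := p.eraseLead_natDegree_le
    omega
  rw [map_add, totalDegree_add_eq_right_of_totalDegree_lt h2, h1]

/-- affine automorphisms -/
def IsA (g : B ≃ₐ[K] B) : Prop := ∀ i : Fin 2, ∃ α β γ : K, g (X i) = C α * X 0 + C β * X 1 + C γ

/-- triangular automorphisms -/
def IsT (g : B ≃ₐ[K] B) : Prop :=
  (∃ (a : K) (p : Polynomial K), g (X 0) = C a * X 0 + Polynomial.aeval (X 1) p) ∧
  ∃ b c : K, g (X 1) = C b * X 1 + C c

lemma algEquiv_C (g : B ≃ₐ[K] B) (a : K) : g (C a) = C a := by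
  rw [← algebraMap_eq]; exact g.commutes a

lemma IsA_one : IsA (1 : B ≃ₐ[K] B) := by
  intro i
  fin_cases i
  · exact ⟨1, 0, 0, by simp⟩
  · exact ⟨0, 1, 0, by simp⟩

lemma IsA_mul (g h : B ≃ₐ[K] B) (hg : IsA g) (hh : IsA h) : IsA (g * h) := by
  intro i
  obtain ⟨α, β, γ, h1⟩ := hh i
  obtain ⟨a, b, c, h2⟩ := hg 0
  obtain ⟨a', b', c', h3⟩ := hg 1
  refine ⟨α * a + β * a', α * b + β * b', α * c + β * c' + γ, ?_⟩
  rw [AlgEquiv.mul_apply, h1]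
  simp only [map_add, map_mul, algEquiv_C, h2, h3]
  ring

lemma IsT_mul (g h : B ≃ₐ[K] B) (hg : IsT g) (hh : IsT h) : IsT (g * h) := by
  obtain ⟨⟨a, p, h1⟩, b, c, h2⟩ := hg
  obtain ⟨⟨a', p', h3⟩, b', c', h4⟩ := hh
  constructor
  · refine ⟨a' * a, Polynomial.C a' * p + p'.comp (Polynomial.C b * Polynomial.X + Polynomial.C c), ?_⟩
    rw [AlgEquiv.mul_apply, h3]
    have : g (Polynomial.aeval (X 1) p') = Polynomial.aeval (g (X 1)) p' :=
      (Polynomial.aeval_algHom_apply g.toAlgHom (X 1) p').symm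
    rw [map_add, this, map_mul, algEquiv_C, h1, h2, map_add, Polynomial.aeval_comp]
    simp [algebraMap_eq]
    ring
  · refine ⟨b' * b, b' * c + c', ?_⟩
    rw [AlgEquiv.mul_apply, h4]
    simp only [map_add, map_mul, algEquiv_C, h2]
    ring

lemma not_const (g : B ≃ₐ[K] B) (i : Fin 2) (c : K) : g (X i) ≠ C c := by
  intro h
  rw [← algEquiv_C g c] at h
  have := g.injective h
  have := congrArg totalDegree this
  simp at this

lemma tdeg_lin (P Q : B) (α β : K) (c : K) (hα : α ≠ 0) (h : Q.totalDegree < P.totalDegree) :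
    (C α * P + C β * Q + C c).totalDegree = P.totalDegree := by
  have hP : P ≠ 0 := by rintro rfl; simp at h
  have h1 : (C α * P).totalDegree = P.totalDegree := by
    rw [totalDegree_mul_of_isDomain (by simpa using hα) hP, totalDegree_C, zero_add]
  have h2 : (C β * Q).totalDegree ≤ Q.totalDegree := by
    rw [← smul_eq_C_mul]; exact totalDegree_smul_le _ _
  rw [totalDegree_add_eq_left_of_totalDegree_lt, totalDegree_add_eq_left_of_totalDegree_lt, h1]
  · rw [h1]; omega
  · rw [totalDegree_add_eq_left_of_totalDegree_lt, h1, totalDegree_C]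
    · omega
    · rw [h1]; omega

lemma tdeg_lin_le (P Q : B) (α β : K) (c : K) :
    (C α * P + C β * Q + C c).totalDegree ≤ max P.totalDegree Q.totalDegree := by
  refine (totalDegree_add _ _).trans (max_le ((totalDegree_add _ _).trans (max_le_max ?_ ?_)) ?_)
  · rw [← smul_eq_C_mul]; exact totalDegree_smul_le _ _
  · rw [← smul_eq_C_mul]; exact totalDegree_smul_le _ _
  · simp

/-- transition by a triangular non affine map -/
lemma trans_T (φ t : B ≃ₐ[K] B) (ht : IsT t) (hA : ¬ IsA t)
    (h1 : (φ (X 0)).totalDegree ≤ (φ (X 1)).totalDegree) (h2 : 1 ≤ (φ (X 1)).totalDegree) :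
    ((φ * t) (X 1)).totalDegree < ((φ * t) (X 0)).totalDegree ∧ 1 ≤ ((φ * t) (X 1)).totalDegree := by
  obtain ⟨⟨a, p, h3⟩, b, c, h4⟩ := ht
  have hb : b ≠ 0 := by
    rintro rfl
    exact not_const t 1 c (by rw [h4]; simp)
  have hp : 2 ≤ p.natDegree := by
    by_contra hcon
    push Not at hcon
    apply hA
    intro i
    fin_cases i
    · rw [Polynomial.eq_X_add_C_of_natDegree_le_one (by omega : p.natDegree ≤ 1)] at h3
      refine ⟨a, p.coeff 1, p.coeff 0, ?_⟩
      simp only [Fin.zero_eta, Fin.isValue]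
      rw [h3]; simp [algebraMap_eq]; ring
    · refine ⟨0, b, c, ?_⟩
      simp only [Fin.mk_one, Fin.isValue]
      rw [h4]; simp
  have e1 : (φ * t) (X 1) = C b * φ (X 1) + C 0 * φ (X 1) + C c := by
    rw [AlgEquiv.mul_apply, h4, map_add, map_mul, algEquiv_C, algEquiv_C]; simp
  have e0 : (φ * t) (X 0) = C a * φ (X 0) + Polynomial.aeval (φ (X 1)) p := by
    have : φ (Polynomial.aeval (X 1) p) = Polynomial.aeval (φ (X 1)) p :=
      (Polynomial.aeval_algHom_apply φ.toAlgHom (X 1) p).symm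
    rw [AlgEquiv.mul_apply, h3, map_add, map_mul, algEquiv_C, this]
  have d1 : ((φ * t) (X 1)).totalDegree = (φ (X 1)).totalDegree := by
    rw [e1]
    have := tdeg_lin (φ (X 1)) 0 b 0 c hb (by rw [totalDegree_zero]; omega)
    simpa using this
  have d0 : ((φ * t) (X 0)).totalDegree = p.natDegree * (φ (X 1)).totalDegree := by
    rw [e0, totalDegree_add_eq_right_of_totalDegree_lt, deg_aeval_eq _ h2 _ (by omega)]
    rw [deg_aeval_eq _ h2 _ (by omega), ← smul_eq_C_mul]
    refine (totalDegree_smul_le _ _).trans_lt ?_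
    nlinarith
  rw [d1, d0]
  exact ⟨by nlinarith, h2⟩

lemma trans_A_aux (t : B ≃ₐ[K] B) (ht : IsA t) (hA : ¬ IsT t) :
    ∃ α β γ a b c : K, t (X 0) = C α * X 0 + C β * X 1 + C γ ∧ t (X 1) = C a * X 0 + C b * X 1 + C c ∧
     a ≠ 0 := by
  obtain ⟨α, β, γ, h1⟩ := ht 0
  obtain ⟨a, b, c, h2⟩ := ht 1
  refine ⟨α, β, γ, a, b, c, h1, h2, ?_⟩
  rintro rfl
  apply hA
  refine ⟨⟨α, Polynomial.C β * Polynomial.X + Polynomial.C γ, ?_⟩, b, c, ?_⟩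
  · rw [h1]; simp [algebraMap_eq]; ring
  · rw [h2]; simp

lemma trans_A (φ t : B ≃ₐ[K] B) (ht : IsA t) (hA : ¬ IsT t)
    (h1 : (φ (X 1)).totalDegree < (φ (X 0)).totalDegree) :
    ((φ * t) (X 0)).totalDegree ≤ ((φ * t) (X 1)).totalDegree ∧
      ((φ * t) (X 1)).totalDegree = (φ (X 0)).totalDegree := by
  obtain ⟨α, β, γ, a, b, c, h3, h4, ha⟩ := trans_A_aux t ht hA
  have e1 : (φ * t) (X 1) = C a * φ (X 0) + C b * φ (X 1) + C c := by
    rw [AlgEquiv.mul_apply, h4]; simp only [map_add, map_mul, algEquiv_C]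
  have e0 : (φ * t) (X 0) = C α * φ (X 0) + C β * φ (X 1) + C γ := by
    rw [AlgEquiv.mul_apply, h3]; simp only [map_add, map_mul, algEquiv_C]
  have d1 := tdeg_lin (φ (X 0)) (φ (X 1)) a b c ha h1
  have d0 := tdeg_lin_le (φ (X 0)) (φ (X 1)) α β γ
  rw [← e1] at d1
  rw [← e0] at d0
  refine ⟨?_, d1⟩
  rw [d1]
  rwa [max_eq_left h1.le] at d0

lemma word_deg (l : List (B ≃ₐ[K] B)) :
    ∀ g, (l ++ [g]).IsChain (alt IsA IsT) →
    (IsT g → ¬ IsA g → ((l ++ [g]).prod (X 1)).totalDegree < ((l ++ [g]).prod (X 0)).totalDegree ∧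
       1 ≤ ((l ++ [g]).prod (X 1)).totalDegree) ∧
    (IsA g → ¬ IsT g → ((l ++ [g]).prod (X 0)).totalDegree ≤ ((l ++ [g]).prod (X 1)).totalDegree ∧
       1 ≤ ((l ++ [g]).prod (X 1)).totalDegree ∧
       (l ≠ [] → 2 ≤ ((l ++ [g]).prod (X 1)).totalDegree)) := by
  induction l using List.reverseRecOn with
  | nil =>
    intro g _
    constructor
    · intro h1 h2
      have := trans_T 1 g h1 h2 (by simp) (by simp)
      simpa using this
    · intro h1 h2
      obtain ⟨α, β, γ, a, b, c, h3, h4, ha⟩ := trans_A_aux g h1 h2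
      have hd : 1 ≤ (g (X 1)).totalDegree := by
        by_contra hcon
        have h0 : (g (X 1)).totalDegree = 0 := by omega
        rw [totalDegree_eq_zero_iff_eq_C] at h0
        exact not_const g 1 _ h0
      have h5 := tdeg_lin_le (X 0 : B) (X 1) α β γ
      rw [← h3] at h5
      simp at h5
      simp
      exact ⟨h5.trans hd, hd⟩
  | append_singleton l h ih =>
    intro g hch
    rw [List.append_assoc, List.singleton_append] at hch
    have hch1 : (l ++ [h]).IsChain (alt IsA IsT) := by
      have : l ++ [h, g] = (l ++ [h]) ++ [g] := by simp
      rw [this] at hch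
      exact hch.left_of_append
    have hr : alt IsA IsT h g := by
      have := hch.right_of_append
      simpa using this
    have ih := ih h hch1
    rw [List.prod_append, List.prod_singleton]
    constructor
    · intro h1 h2
      have h3 : IsA h ∧ ¬ IsT h := by
        rcases hr with h | h
        · exact ⟨h.1, h.2.1⟩
        · exact absurd h.2.2.1 h2
      have := ih.2 h3.1 h3.2
      exact trans_T _ g h1 h2 this.1 this.2.1
    · intro h1 h2
      have h3 : IsT h ∧ ¬ IsA h := by
        rcases hr with h | h
        · exact absurd h.2.2.1 h2
        · exact ⟨h.1, h.2.1⟩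
      have := ih.1 h3.1 h3.2
      have h4 := trans_A _ g h1 h2 this.1
      refine ⟨h4.1, ?_, fun _ => ?_⟩ <;> omega

lemma word_ne (l : List (B ≃ₐ[K] B)) (hl : 2 ≤ l.length) (hch : l.IsChain (alt IsA IsT)) :
    l.prod ≠ 1 := by
  have hl' : l ≠ [] := by rintro rfl; simp at hl
  obtain ⟨m, g, rfl⟩ : ∃ m g, l = m ++ [g] := ⟨_, _, (List.dropLast_append_getLast hl').symm⟩
  intro h1
  have hw := word_deg m g hch
  have hm : m ≠ [] := by rintro rfl; simp at hl
  obtain ⟨m', h, rfl⟩ : ∃ m' h, m = m' ++ [h] := ⟨_, _, (List.dropLast_append_getLast hm).symm⟩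
  have hr : alt IsA IsT h g := by
    rw [List.append_assoc, List.singleton_append] at hch
    have := hch.right_of_append
    simpa using this
  rw [h1] at hw
  rcases hr with h | h
  · have := (hw.1 h.2.2.1 h.2.2.2).1
    simp at this
  · have := (hw.2 h.2.2.1 h.2.2.2).2.2 (by simp)
    simp at this
end fld

end RealForm

set_option linter.unusedSectionVars false
open MvPolynomial

namespace RealForm

section fld2
variable {K : Type*} [Field K] [CharZero K]

local notation "B" => MvPolynomial (Fin 2) K

lemma gen_img {L : Type*} [CommRing L] {A A' : Type*} [CommRing A] [CommRing A'] [Algebra L A] [Algebra L A']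
    (g : A →ₐ[L] A') (hg : Function.Surjective g) (u v : A) (h : gen L u v = ⊤) : gen L (g u) (g v) = ⊤ := by
  rw [eq_top_iff]
  intro f _
  obtain ⟨f', rfl⟩ := hg f
  have : f' ∈ gen L u v := by rw [h]; trivial
  obtain ⟨H, rfl⟩ := this
  refine ⟨H, ?_⟩
  have : ![g u, g v] = fun i => g (![u, v] i) := by
    ext i; fin_cases i <;> rfl
  change aeval ![g u, g v] H = g (aeval ![u, v] H)
  rw [this, ← AlgHom.comp_apply, comp_aeval]

lemma gen_X {R : Type*} [CommRing R] [IsDomain R] : gen R (X 0 : MvPolynomial (Fin 2) R) (X 1) = ⊤ :=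
  top_of_X (left_mem_gen _ _) (right_mem_gen _ _)

lemma alg_ext (g h : B ≃ₐ[K] B) (h0 : g (X 0) = h (X 0)) (h1 : g (X 1) = h (X 1)) : g = h := by
  have : g.toAlgHom = h.toAlgHom := by
    apply MvPolynomial.algHom_ext
    intro i; fin_cases i
    · exact h0
    · exact h1
  apply AlgEquiv.ext
  intro x
  exact DFunLike.congr_fun this x

/-- the swap -/
noncomputable def sw : B ≃ₐ[K] B := AlgEquiv.ofAlgHom (aeval ![X 1, X 0]) (aeval ![X 1, X 0])
  (by apply MvPolynomial.algHom_ext; intro i; fin_cases i <;> simp)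
  (by apply MvPolynomial.algHom_ext; intro i; fin_cases i <;> simp)

/-- elementary map -/
noncomputable def el (a b : K) (hb : b ≠ 0) (k : ℕ) : B ≃ₐ[K] B :=
  AlgEquiv.ofAlgHom (aeval ![C b * X 0 + C a * X 1 ^ k, X 1])
    (aeval ![C b⁻¹ * X 0 - C (b⁻¹ * a) * X 1 ^ k, X 1])
  (by
    apply MvPolynomial.algHom_ext; intro i; fin_cases i
    · have : (C b : B) * C b⁻¹ = 1 := by rw [← C_mul, mul_inv_cancel₀ hb, C_1]
      simp [algebraMap_eq, aeval_C]
      linear_combination (X 0) * this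
    · simp)
  (by
    apply MvPolynomial.algHom_ext; intro i; fin_cases i
    · have : (C b : B) * C b⁻¹ = 1 := by rw [← C_mul, mul_inv_cancel₀ hb, C_1]
      simp [algebraMap_eq, aeval_C]
      linear_combination (X 0 - C a * X 1 ^ k) * this
    · simp)

lemma words : ∀ u v : B, GP u v → ∀ g : B ≃ₐ[K] B, g (X 0) = u → g (X 1) = v →
    ∃ l : List (B ≃ₐ[K] B), (∀ h ∈ l, IsA h ∨ IsT h) ∧ l.prod = g := by
  apply jungInd
  · intro a b c p _ _ g h0 h1
    refine ⟨[g], ?_, by simp⟩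
    intro h hh
    simp at hh
    subst hh
    exact Or.inr ⟨⟨a, p, h0⟩, b, c, h1⟩
  · intro u v _ ih g h0 h1
    obtain ⟨l, hl, hp⟩ := ih (g * sw) (by simp [sw, h1]) (by simp [sw, h0])
    refine ⟨l ++ [sw], ?_, ?_⟩
    · intro h hh
      simp at hh
      rcases hh with hh | rfl
      · exact hl h hh
      · left
        intro i; fin_cases i
        · exact ⟨0, 1, 0, by simp [sw]⟩
        · exact ⟨1, 0, 0, by simp [sw]⟩
    · rw [List.prod_append, hp]
      apply alg_ext <;> simp [sw]
  · intro u v a b k hb _ _ ih g h0 h1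
    obtain ⟨l, hl, hp⟩ := ih (g * el a b hb k)
      (by simp [el, h0, h1, algEquiv_C]) (by simp [el, h1])
    refine ⟨l ++ [(el a b hb k)⁻¹], ?_, ?_⟩
    · intro h hh
      simp at hh
      rcases hh with hh | rfl
      · exact hl h hh
      · right
        refine ⟨⟨b⁻¹, - Polynomial.C (b⁻¹ * a) * Polynomial.X ^ k, ?_⟩, 1, 0, ?_⟩
        · change (aeval ![C b⁻¹ * X 0 - C (b⁻¹ * a) * X 1 ^ k, X 1]) (X 0) = _
          simp [algebraMap_eq]; ring
        · change (aeval ![C b⁻¹ * X 0 - C (b⁻¹ * a) * X 1 ^ k, X 1]) (X 1) = _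
          simp
    · rw [List.prod_append, hp]
      simp

lemma words' (g : B ≃ₐ[K] B) :
    ∃ l : List (B ≃ₐ[K] B), (∀ h ∈ l, IsA h ∨ IsT h) ∧ l.prod = g := by
  refine words _ _ ?_ g rfl rfl
  rw [GP, eq_top_iff, ← gen_img g.toAlgHom g.surjective (X 0) (X 1) gen_X]
  exact le_sat _

variable (s : K ≃+* K)

/-- conjugate automorphism -/
noncomputable def barE (hs : ∀ a, s (s a) = a) (g : B ≃ₐ[K] B) : B ≃ₐ[K] B :=
  AlgEquiv.ofRingEquiv (f := ((mapEquiv (Fin 2) s).trans g.toRingEquiv).trans (mapEquiv (Fin 2) s))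
    (by
      intro r
      simp only [RingEquiv.trans_apply, algebraMap_eq]
      simp [hs, algEquiv_C])

lemma barE_apply (hs : ∀ a, s (s a) = a) (g : B ≃ₐ[K] B) (P : B) :
    barE s hs g P = map (s : K →+* K) (g (map (s : K →+* K) P)) := rfl

lemma map_map_s (hs : ∀ a, s (s a) = a) (P : B) : map (s : K →+* K) (map (s : K →+* K) P) = P := by
  rw [map_map]
  have : (s : K →+* K).comp (s : K →+* K) = RingHom.id K := by ext a; exact hs a
  rw [this, map_id]

noncomputable def barH (hs : ∀ a, s (s a) = a) : (B ≃ₐ[K] B) →* (B ≃ₐ[K] B) where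
  toFun := barE s hs
  map_one' := by ext1 P; rw [barE_apply]; simp only [AlgEquiv.one_apply]; exact map_map_s s hs P
  map_mul' g h := by
    ext1 P
    rw [AlgEquiv.mul_apply, barE_apply, barE_apply, barE_apply, map_map_s s hs]; rfl

lemma map_aevalX (p : Polynomial K) : map (s : K →+* K) (Polynomial.aeval (X 1 : B) p) =
    Polynomial.aeval (X 1) (p.map (s : K →+* K)) := by
  rw [Polynomial.aeval_def, Polynomial.aeval_def, Polynomial.hom_eval₂, Polynomial.eval₂_map, map_X]
  congr 1
  ext a
  simp [algebraMap_eq]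

lemma gen_T (u v : B) (a b c : K) (p : Polynomial K) (ha : a ≠ 0) (hb : b ≠ 0)
    (hu : u = C a * X 0 + Polynomial.aeval (X 1) p) (hv : v = C b * X 1 + C c) : gen K u v = ⊤ := by
  have hC : ∀ a : K, (C a : B) ∈ gen K u v := fun a => by
    rw [← algebraMap_eq]; exact Subalgebra.algebraMap_mem _ _
  have h1 : X 1 ∈ gen K u v := by
    have h2 := Subalgebra.mul_mem _ (hC b⁻¹) (Subalgebra.sub_mem _ (right_mem_gen (R := K) u v) (hC c))
    have h3 : (C b⁻¹ * C b : B) = 1 := by rw [← C_mul, inv_mul_cancel₀ hb, C_1]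
    have : C b⁻¹ * (v - C c) = X 1 := by
      rw [hv]; linear_combination (X 1) * h3
    rwa [this] at h2
  refine top_of_X ?_ h1
  have hp : Polynomial.aeval (X 1) p ∈ gen K u v := by
    rw [Polynomial.aeval_eq_sum_range]
    exact Subalgebra.sum_mem _ (fun i _ => Subalgebra.smul_mem _ (Subalgebra.pow_mem _ h1 i) _)
  have h2 := Subalgebra.mul_mem _ (hC a⁻¹) (Subalgebra.sub_mem _ (left_mem_gen (R := K) u v) hp)
  have h3 : (C a⁻¹ * C a : B) = 1 := by rw [← C_mul, inv_mul_cancel₀ ha, C_1]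
  have : C a⁻¹ * (u - Polynomial.aeval (X 1) p) = X 0 := by
    rw [hu]; linear_combination (X 0) * h3
  rwa [this] at h2

lemma gen_A (u v : B) (a b c a' b' c' : K) (hd : a * b' - b * a' ≠ 0)
    (hu : u = C a * X 0 + C b * X 1 + C c) (hv : v = C a' * X 0 + C b' * X 1 + C c') :
    gen K u v = ⊤ := by
  have hC : ∀ a : K, (C a : B) ∈ gen K u v := fun a => by
    rw [← algebraMap_eq]; exact Subalgebra.algebraMap_mem _ _
  have hu' := Subalgebra.sub_mem _ (left_mem_gen (R := K) u v) (hC c)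
  have hv' := Subalgebra.sub_mem _ (right_mem_gen (R := K) u v) (hC c')
  set d := a * b' - b * a' with hd'
  have h3 : (C d⁻¹ * C d : B) = 1 := by rw [← C_mul, inv_mul_cancel₀ hd, C_1]
  have h4 : (C d : B) = C a * C b' - C b * C a' := by simp [hd']
  apply top_of_X
  · have := Subalgebra.mul_mem _ (hC d⁻¹) (Subalgebra.sub_mem _ (Subalgebra.mul_mem _ (hC b') hu')
      (Subalgebra.mul_mem _ (hC b) hv'))
    have e : C d⁻¹ * (C b' * (u - C c) - C b * (v - C c')) = X 0 := by
      rw [hu, hv]; linear_combination (X 0) * h3 - C d⁻¹ * X 0 * h4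
    rwa [e] at this
  · have := Subalgebra.mul_mem _ (hC d⁻¹) (Subalgebra.sub_mem _ (Subalgebra.mul_mem _ (hC a) hv')
      (Subalgebra.mul_mem _ (hC a') hu'))
    have e : C d⁻¹ * (C a * (v - C c') - C a' * (u - C c)) = X 1 := by
      rw [hu, hv]; linear_combination (X 1) * h3 - C d⁻¹ * X 1 * h4
    rwa [e] at this

theorem real_pair_field (hs : ∀ a, s (s a) = a) (ι : K) (hι : ι ≠ 0) (hsι : s ι = -ι) (ν : B ≃ₐ[K] B)
    (hν : ∀ P, ν (map (s : K →+* K) (ν (map (s : K →+* K) P))) = P) :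
    ∃ u v : B, ν (map (s : K →+* K) u) = u ∧ ν (map (s : K →+* K) v) = v ∧ gen K u v = ⊤ := by
  obtain ⟨l, hl, rfl⟩ := words' ν
  have hbb : ∀ g : B ≃ₐ[K] B, barH s hs (barH s hs g) = g := by
    intro g
    ext1 P
    change map (s : K →+* K) (barE s hs g (map (s : K →+* K) P)) = _
    rw [barE_apply, map_map_s s hs, map_map_s s hs]
  obtain ⟨g, hg⟩ := kamb (barH s hs) IsA IsT IsA_one IsA_mul IsT_mul
    (by
      intro g hg i
      obtain ⟨α, β, γ, h⟩ := hg i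
      refine ⟨s α, s β, s γ, ?_⟩
      change barE s hs g (X i) = _
      rw [barE_apply, map_X, h]
      simp)
    (by
      rintro g ⟨⟨a, p, h⟩, b, c, h'⟩
      refine ⟨⟨s a, p.map (s : K →+* K), ?_⟩, s b, s c, ?_⟩
      · change barE s hs g (X 0) = _
        rw [barE_apply, map_X, h, map_add, map_aevalX]
        simp
      · change barE s hs g (X 1) = _
        rw [barE_apply, map_X, h']
        simp) hbb word_ne _ l rfl hl
    (by ext1 P; exact hν P)
  set ν := l.prod with hνdef
  set μ := g⁻¹ * ν * barH s hs g with hμ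
  -- the semilinear involution
  have hcoc : ∀ P, μ (map (s : K →+* K) (μ (map (s : K →+* K) P))) = P := by
    have h1 : ν * barH s hs ν = 1 := by ext1 P; exact hν P
    have : μ * barH s hs μ = 1 := by
      rw [hμ, map_mul, map_mul, hbb, map_inv]
      calc g⁻¹ * ν * barH s hs g * ((barH s hs g)⁻¹ * barH s hs ν * g)
          = g⁻¹ * (ν * barH s hs ν) * g := by group
        _ = 1 := by rw [h1]; group
    intro P
    exact DFunLike.congr_fun this P
  suffices ∃ u v : B, μ (map (s : K →+* K) u) = u ∧ μ (map (s : K →+* K) v) = v ∧ gen K u v = ⊤ by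
    obtain ⟨u, v, hu, hv, huv⟩ := this
    have key : ∀ P, ν (map (s : K →+* K) (g P)) = g (μ (map (s : K →+* K) P)) := by
      intro P
      rw [hμ, AlgEquiv.mul_apply, AlgEquiv.mul_apply]
      have h2 : ∀ Q, g (g⁻¹ Q) = Q := fun Q => by
        rw [← AlgEquiv.mul_apply, mul_inv_cancel, AlgEquiv.one_apply]
      rw [h2]
      change _ = ν (map (s : K →+* K) (g (map (s : K →+* K) (map (s : K →+* K) P))))
      rw [map_map_s s hs]
    refine ⟨g u, g v, by rw [key, hu], by rw [key, hv], gen_img g.toAlgHom g.surjective u v huv⟩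
  clear_value μ
  have re : ∀ w : B, μ (map (s : K →+* K) (w + μ (map (s : K →+* K) w))) = w + μ (map (s : K →+* K) w) := by
    intro w
    rw [map_add, map_add, hcoc, add_comm]
  have im : ∀ w : B, μ (map (s : K →+* K) (C ι * (w - μ (map (s : K →+* K) w)))) =
      C ι * (w - μ (map (s : K →+* K) w)) := by
    intro w
    rw [map_mul, map_mul, map_sub, map_sub, hcoc, map_C, algEquiv_C, RingEquiv.coe_toRingHom, hsι, C_neg]
    ring
  have h2 : (2 : K) ≠ 0 := two_ne_zero
  rcases hg with hg | hg
  · obtain ⟨a, b, c, e0⟩ := hg 0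
    obtain ⟨a', b', c', e1⟩ := hg 1
    have re0 := re (X 0)
    have re1 := re (X 1)
    have im0 := im (X 0)
    have im1 := im (X 1)
    rw [map_X, e0] at re0 im0
    rw [map_X, e1] at re1 im1
    have r0 : (X 0 : B) + (C a * X 0 + C b * X 1 + C c) = C (1 + a) * X 0 + C b * X 1 + C c := by
      simp only [C_add, C_1]; ring
    have r1 : (X 1 : B) + (C a' * X 0 + C b' * X 1 + C c') = C a' * X 0 + C (1 + b') * X 1 + C c' := by
      simp only [C_add, C_1]; ring
    have i0 : C ι * ((X 0 : B) - (C a * X 0 + C b * X 1 + C c)) =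
       C (ι * (1 - a)) * X 0 + C (- ι * b) * X 1 + C (- ι * c) := by
      simp only [C_mul, C_neg, C_sub, C_1]; ring
    have i1 : C ι * ((X 1 : B) - (C a' * X 0 + C b' * X 1 + C c')) =
       C (- ι * a') * X 0 + C (ι * (1 - b')) * X 1 + C (- ι * c') := by
      simp only [C_mul, C_neg, C_sub, C_1]; ring
    rw [r0] at re0
    rw [r1] at re1
    rw [i0] at im0
    rw [i1] at im1
    by_cases d1 : (1 + a) * (1 + b') - b * a' ≠ 0
    · exact ⟨_, _, re0, re1, gen_A _ _ _ _ _ _ _ _ d1 rfl rfl⟩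
    by_cases d2 : (1 + a) * (ι * (1 - b')) - b * (- ι * a') ≠ 0
    · exact ⟨_, _, re0, im1, gen_A _ _ _ _ _ _ _ _ d2 rfl rfl⟩
    by_cases d3 : (ι * (1 - a)) * (1 + b') - (- ι * b) * a' ≠ 0
    · exact ⟨_, _, im0, re1, gen_A _ _ _ _ _ _ _ _ d3 rfl rfl⟩
    by_cases d4 : (ι * (1 - a)) * (ι * (1 - b')) - (- ι * b) * (- ι * a') ≠ 0
    · exact ⟨_, _, im0, im1, gen_A _ _ _ _ _ _ _ _ d4 rfl rfl⟩
    exfalso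
    push Not at d1 d2 d3 d4
    have : ι ^ 2 * (2 * 2) = 0 := by
      linear_combination ι ^ 2 * d1 + ι * d2 + ι * d3 + d4
    exact mul_ne_zero (pow_ne_zero _ hι) (mul_ne_zero h2 h2) this
  · obtain ⟨⟨a, p, e0⟩, b, c, e1⟩ := hg
    have re0 := re (X 0)
    have re1 := re (X 1)
    have im0 := im (X 0)
    have im1 := im (X 1)
    rw [map_X, e0] at re0 im0
    rw [map_X, e1] at re1 im1
    have H1 : ∃ (b' c' : K) (v : B), b' ≠ 0 ∧ v = C b' * X 1 + C c' ∧ μ (map (s : K →+* K) v) = v := by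
      by_cases hb : 1 + b ≠ 0
      · exact ⟨1 + b, c, _, hb, by simp only [C_add, C_1]; ring, re1⟩
      · have : 1 - b ≠ 0 := by
          intro h
          push Not at hb
          exact h2 (by linear_combination hb + h)
        exact ⟨ι * (1 - b), - ι * c, _, mul_ne_zero hι this,
          by simp only [C_mul, C_neg, C_sub, C_1]; ring, im1⟩
    have H0 : ∃ (a' : K) (p' : Polynomial K) (u : B), a' ≠ 0 ∧
        u = C a' * X 0 + Polynomial.aeval (X 1) p' ∧ μ (map (s : K →+* K) u) = u := by
      by_cases ha : 1 + a ≠ 0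
      · exact ⟨1 + a, p, _, ha, by simp only [C_add, C_1]; ring, re0⟩
      · have : 1 - a ≠ 0 := by
          intro h
          push Not at ha
          exact h2 (by linear_combination ha + h)
        exact ⟨ι * (1 - a), - Polynomial.C ι * p, _, mul_ne_zero hι this,
          by simp only [C_mul, C_sub, C_1, map_mul, map_neg, Polynomial.aeval_C, algebraMap_eq]; ring, im0⟩
    obtain ⟨b', c', v, hb, hv, hv'⟩ := H1
    obtain ⟨a', p', u, ha, hu, hu'⟩ := H0
    exact ⟨u, v, hu', hv', gen_T _ _ _ _ _ _ ha hb hu hv⟩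

end fld2
end RealForm

set_option linter.unusedSectionVars false
open MvPolynomial

namespace RealForm

lemma alg_indep_aux {R : Type*} [CommRing R] [IsDomain R] [CharZero R] {u v : MvPolynomial (Fin 2) R}
    (hj : jac u v ≠ 0) (n : ℕ) : ∀ H : MvPolynomial (Fin 2) R, H.totalDegree ≤ n →
      aeval ![u, v] H = 0 → H = 0 := by
  induction n with
  | zero =>
    intro H hH h0
    have := (totalDegree_eq_zero_iff_eq_C (p := H)).1 (by omega)
    rw [this, aeval_C, algebraMap_eq, C_eq_zero] at h0
    rw [this, h0, C_0]
  | succ n ih =>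
    intro H hH h0
    have hdeg : ∀ i, (pderiv i H).totalDegree ≤ n := by
      intro i
      refine Finset.sup_le ?_
      intro m hm
      rw [mem_support_iff, coeff_pderiv] at hm
      have hm' : m + Finsupp.single i 1 ∈ H.support := by
        rw [mem_support_iff]; intro h; exact hm (by rw [h, zero_mul])
      have := le_totalDegree hm'
      rw [Finsupp.sum_add_index' (by simp) (by simp)] at this
      simp at this
      simp [Finsupp.sum] at this ⊢
      omega
    have hv : ∀ i, pderiv i H = 0 := by
      have e0 : jac (aeval ![u, v] H) (aeval ![u, v] (X 1 : MvPolynomial (Fin 2) R)) = 0 := by rw [h0]; simp [jac]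
      have e1 : jac (aeval ![u, v] (X 0 : MvPolynomial (Fin 2) R)) (aeval ![u, v] H) = 0 := by rw [h0]; simp [jac]
      rw [jac_aeval] at e0 e1
      have e0 := (mul_eq_zero.1 e0).resolve_right hj
      have e1 := (mul_eq_zero.1 e1).resolve_right hj
      have f0 : jac H (X 1) = pderiv 0 H := by simp [jac, pderiv_X]
      have f1 : jac (X 0) H = pderiv 1 H := by simp [jac, pderiv_X]
      rw [f0] at e0
      rw [f1] at e1
      intro i; fin_cases i
      · exact ih _ (hdeg 0) e0
      · exact ih _ (hdeg 1) e1
    have : H = C (coeff 0 H) := by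
      ext m
      rw [coeff_C]
      split_ifs with h
      · rw [h]
      · have : ∃ i, m i ≠ 0 := by
          by_contra hcon
          push Not at hcon
          exact h (by ext i; simp [hcon])
        obtain ⟨i, hi⟩ := this
        have h2 := coeff_pderiv (i := i) (p := H) (m - Finsupp.single i 1)
        rw [hv i, coeff_zero, tsub_add_cancel_of_le (by simpa using Nat.one_le_iff_ne_zero.2 hi)] at h2
        rcases mul_eq_zero.1 h2.symm with h3 | h3
        · exact h3
        · exact absurd h3 (Nat.cast_add_one_ne_zero _)
    rw [this, aeval_C, algebraMap_eq, C_eq_zero] at h0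
    rw [this, h0, C_0]

lemma alg_indep {R : Type*} [CommRing R] [IsDomain R] [CharZero R] {u v : MvPolynomial (Fin 2) R}
    (hj : jac u v ≠ 0) {H H' : MvPolynomial (Fin 2) R} (h : aeval ![u, v] H = aeval ![u, v] H') : H = H' := by
  rw [← sub_eq_zero]
  apply alg_indep_aux hj _ _ le_rfl
  rw [map_sub, h, sub_self]

section gens
variable {R : Type*} [CommRing R] {A : Type*} [CommRing A] [Algebra R A]

/-- change first generator by an element of the algebra generated by the second -/
lemma gen_add (u v w : A) (hw : w ∈ Algebra.adjoin R {v}) : gen R (u + w) v = gen R u v := by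
  have h : ∀ x : A, w ∈ gen R x v := fun x => by
    have : Algebra.adjoin R {v} ≤ gen R x v := by
      rw [gen_eq_adjoin]; exact Algebra.adjoin_mono (by simp)
    exact this hw
  apply le_antisymm
  · exact gen_le (Subalgebra.add_mem _ (left_mem_gen _ _) (h _)) (right_mem_gen _ _)
  · refine gen_le ?_ (right_mem_gen _ _)
    have := Subalgebra.sub_mem _ (left_mem_gen (R := R) (u + w) v) (h (u + w))
    simpa using this

lemma gen_unit (c : Rˣ) (u v : A) : gen R ((c : R) • u) v = gen R u v := by
  apply le_antisymm
  · exact gen_le (Subalgebra.smul_mem _ (left_mem_gen _ _) _) (right_mem_gen _ _)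
  · refine gen_le ?_ (right_mem_gen _ _)
    have := Subalgebra.smul_mem _ (left_mem_gen (R := R) ((c : R) • u) v) ((c⁻¹ : Rˣ) : R)
    simpa [smul_smul] using this

/-- elements of `R[a, π b]` -/
lemma mem_gen_smul (π : R) (a b f : A) (hf : f ∈ gen R a (π • b)) :
    ∃ (p : Polynomial R) (t : A), t ∈ gen R a b ∧ f = Polynomial.aeval a p + π • t := by
  have hp : ∀ p : Polynomial R, Polynomial.aeval a p ∈ gen R a b := by
    intro p
    rw [Polynomial.aeval_eq_sum_range]
    exact Subalgebra.sum_mem _ (fun i _ => Subalgebra.smul_mem _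
      (Subalgebra.pow_mem _ (left_mem_gen _ _) i) _)
  rw [gen_eq_adjoin] at hf
  induction hf using Algebra.adjoin_induction with
  | mem x hx =>
    rcases hx with rfl | rfl
    · exact ⟨Polynomial.X, 0, Subalgebra.zero_mem _, by simp⟩
    · exact ⟨0, b, right_mem_gen _ _, by simp⟩
  | algebraMap r => exact ⟨Polynomial.C r, 0, Subalgebra.zero_mem _, by simp⟩
  | add x y _ _ hx hy =>
    obtain ⟨p, t, ht, rfl⟩ := hx
    obtain ⟨p', t', ht', rfl⟩ := hy
    exact ⟨p + p', t + t', Subalgebra.add_mem _ ht ht', by simp; abel⟩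
  | mul x y _ _ hx hy =>
    obtain ⟨p, t, ht, rfl⟩ := hx
    obtain ⟨p', t', ht', rfl⟩ := hy
    refine ⟨p * p', Polynomial.aeval a p * t' + t * Polynomial.aeval a p' + π • (t * t'), ?_, ?_⟩
    · exact Subalgebra.add_mem _ (Subalgebra.add_mem _ (Subalgebra.mul_mem _ (hp p) ht')
        (Subalgebra.mul_mem _ ht (hp p'))) (Subalgebra.smul_mem _ (Subalgebra.mul_mem _ ht ht') _)
    · simp only [map_mul, Algebra.smul_def]; ring

/-- elements of `R[π a, π b]` -/
lemma mem_gen_smul2 (π : R) (a b f : A) (hf : f ∈ gen R (π • a) (π • b)) :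
    ∃ (c : R) (t : A), t ∈ gen R a b ∧ f = algebraMap R A c + π • t := by
  rw [gen_eq_adjoin] at hf
  induction hf using Algebra.adjoin_induction with
  | mem x hx =>
    rcases hx with rfl | rfl
    · exact ⟨0, a, left_mem_gen _ _, by simp⟩
    · exact ⟨0, b, right_mem_gen _ _, by simp⟩
  | algebraMap r => exact ⟨r, 0, Subalgebra.zero_mem _, by simp⟩
  | add x y _ _ hx hy =>
    obtain ⟨p, t, ht, rfl⟩ := hx
    obtain ⟨p', t', ht', rfl⟩ := hy
    exact ⟨p + p', t + t', Subalgebra.add_mem _ ht ht', by simp; abel⟩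
  | mul x y _ _ hx hy =>
    obtain ⟨p, t, ht, rfl⟩ := hx
    obtain ⟨p', t', ht', rfl⟩ := hy
    refine ⟨p * p', p • t' + p' • t + π • (t * t'), ?_, ?_⟩
    · exact Subalgebra.add_mem _ (Subalgebra.add_mem _ (Subalgebra.smul_mem _ ht' _)
        (Subalgebra.smul_mem _ ht _)) (Subalgebra.smul_mem _ (Subalgebra.mul_mem _ ht ht') _)
    · simp only [map_mul, Algebra.smul_def]; ring

end gens

section dvr
variable {O k : Type*} [CommRing O] [IsDomain O] [Field k] (ε : O →+* k) (π : O)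

/-- data of a discrete valuation ring with residue map -/
structure DV : Prop where
  surj : Function.Surjective ε
  ker : ∀ c, ε c = 0 ↔ π ∣ c
  ne : π ≠ 0
  fac : ∀ b : O, b ≠ 0 → ∃ (w : Oˣ) (e : ℕ), b = w * π ^ e

local notation "S" => MvPolynomial (Fin 2) O

variable {ε π}

lemma DV.map_zero_iff (D : DV ε π) (f : S) : map ε f = 0 ↔ ∃ g : S, f = π • g := by
  constructor
  · intro h
    have : C π ∣ f := by
      rw [C_dvd_iff_dvd_coeff]
      intro i
      rw [← D.ker, ← coeff_map, h, coeff_zero]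
    obtain ⟨g, hg⟩ := this
    exact ⟨g, by rw [hg, smul_eq_C_mul]⟩
  · rintro ⟨g, rfl⟩
    rw [smul_eq_C_mul, map_mul, map_C, (D.ker π).2 dvd_rfl]; simp

lemma map_aeval_poly (a : S) (p : Polynomial O) :
    map ε (Polynomial.aeval a p) = Polynomial.aeval (map ε a) (p.map ε) := by
  rw [Polynomial.aeval_def, Polynomial.aeval_def, Polynomial.hom_eval₂, Polynomial.eval₂_map]
  congr 1
  ext a
  simp [algebraMap_eq]

lemma DV.map_smul (D : DV ε π) (t : S) : map ε (π • t) = 0 := (D.map_zero_iff _).2 ⟨t, rfl⟩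

lemma transc {f : MvPolynomial (Fin 2) k} (hf : 1 ≤ f.totalDegree) (p : Polynomial k)
    (h : Polynomial.aeval f p = 0) : p = 0 := by
  rcases Nat.eq_zero_or_pos p.natDegree with h0 | h0
  · rw [Polynomial.eq_C_of_natDegree_eq_zero h0] at h ⊢
    rw [Polynomial.aeval_C, algebraMap_eq, C_eq_zero] at h
    rw [h, Polynomial.C_0]
  · have := deg_aeval_eq f hf p h0
    rw [h, totalDegree_zero] at this
    have := Nat.mul_pos h0 hf
    omega

lemma smul_cancel (hπ : π ≠ 0) {x y : S} (h : π • x = π • y) : x = y := by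
  rw [smul_eq_C_mul, smul_eq_C_mul] at h
  exact mul_left_cancel₀ (by simpa using hπ) h

lemma DV.claim1 (D : DV ε π) (a b f : S) (ha : 1 ≤ (map ε a).totalDegree)
    (hf : π • f ∈ gen O a (π • b)) : f ∈ gen O a b := by
  obtain ⟨p, t, ht, h⟩ := mem_gen_smul π a b _ hf
  have h1 := congrArg (map ε) h
  rw [map_add, D.map_smul, D.map_smul, add_zero, map_aeval_poly] at h1
  have h2 := transc ha _ h1.symm
  have h3 : Polynomial.C π ∣ p := by
    rw [Polynomial.C_dvd_iff_dvd_coeff]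
    intro i
    rw [← D.ker, ← Polynomial.coeff_map, h2, Polynomial.coeff_zero]
  obtain ⟨q, rfl⟩ := h3
  have h4 : f = Polynomial.aeval a q + t := by
    apply smul_cancel D.ne
    rw [h]
    simp [algebraMap_eq, smul_eq_C_mul]
  rw [h4]
  refine Subalgebra.add_mem _ ?_ ht
  rw [Polynomial.aeval_eq_sum_range]
  exact Subalgebra.sum_mem _ (fun i _ => Subalgebra.smul_mem _
      (Subalgebra.pow_mem _ (left_mem_gen _ _) i) _)

lemma DV.const_of (D : DV ε π) (a b u : S) (ha : (map ε a).totalDegree = 0)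
    (hu : u ∈ gen O a (π • b)) : (map ε u).totalDegree = 0 := by
  obtain ⟨p, t, ht, rfl⟩ := mem_gen_smul π a b _ hu
  rw [map_add, D.map_smul, add_zero, map_aeval_poly]
  have := deg_aeval_le (map ε a) (p.map ε)
  rw [ha, mul_zero] at this
  omega

lemma DV.not_top (D : DV ε π) (a b : S) : gen O a (π • b) ≠ ⊤ := by
  intro h
  have h0 : (X 0 : S) ∈ gen O a (π • b) := by rw [h]; trivial
  have h1 : (X 1 : S) ∈ gen O a (π • b) := by rw [h]; trivial
  obtain ⟨p, t, ht, e0⟩ := mem_gen_smul π a b _ h0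
  obtain ⟨q, t', ht', e1⟩ := mem_gen_smul π a b _ h1
  have e0 := congrArg (map ε) e0
  have e1 := congrArg (map ε) e1
  rw [map_add, D.map_smul, add_zero, map_aeval_poly, map_X] at e0 e1
  have : jac (X 0 : MvPolynomial (Fin 2) k) (X 1) = 1 := by simp [jac, pderiv_X]
  rw [e0, e1, jac, Derivation.map_aeval, Derivation.map_aeval, Derivation.map_aeval,
    Derivation.map_aeval] at this
  simp only [smul_eq_mul] at this
  have h2 : (0 : MvPolynomial (Fin 2) k) = 1 := by rw [← this]; ring
  exact zero_ne_one h2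

lemma DV.split (D : DV ε π) (a : S) (ha : (map ε a).totalDegree = 0) :
    ∃ (c : O) (a' : S), a = π • a' + C c := by
  have h := totalDegree_eq_zero_iff_eq_C.1 ha
  obtain ⟨c, hc⟩ := D.surj (coeff 0 (map ε a))
  have : map ε (a - C c) = 0 := by rw [map_sub, map_C, hc, ← h, sub_self]
  obtain ⟨g, hg⟩ := (D.map_zero_iff _).1 this
  exact ⟨c, g, by rw [← hg]; ring⟩

lemma gen_addC (u v : S) (c : O) : gen O (u + C c) v = gen O u v :=
  gen_add _ _ _ (by rw [← algebraMap_eq]; exact Subalgebra.algebraMap_mem _ _)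

lemma DV.scale (D : DV ε π) (a b u v : S) (h : gen O (π • u) (π • v) ≤ gen O (π • a) (π • b)) :
    gen O u v ≤ gen O a b := by
  have key : ∀ f : S, π • f ∈ gen O (π • a) (π • b) → f ∈ gen O a b := by
    intro f hf
    obtain ⟨c, t, ht, e⟩ := mem_gen_smul2 π a b _ hf
    have e1 := congrArg (map ε) e
    rw [map_add, D.map_smul, D.map_smul, add_zero, algebraMap_eq, map_C] at e1
    obtain ⟨c', rfl⟩ := (D.ker c).1 (by simpa using e1.symm)
    have : f = algebraMap O S c' + t := by
      apply smul_cancel D.ne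
      rw [e, smul_add, map_mul, Algebra.smul_def π (algebraMap O S c')]
    rw [this]
    exact Subalgebra.add_mem _ (Subalgebra.algebraMap_mem _ _) ht
  exact gen_le (key _ (h (left_mem_gen _ _))) (key _ (h (right_mem_gen _ _)))

/-- subalgebras obtained from everything by `N` affine modifications -/
def MM (π : O) : ℕ → Subalgebra O (MvPolynomial (Fin 2) O) → Prop
  | 0, T => T = ⊤
  | n + 1, T => ∃ a b : MvPolynomial (Fin 2) O, T = gen O a (π • b) ∧ MM π n (gen O a b)

lemma DV.div_aux (D : DV ε π) (a b u v : S) (hT : gen O u (π • v) = gen O a (π • b)) :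
    gen O u v = gen O a b ∨ ∃ a' u' : S, gen O a b = gen O b (π • a') ∧ gen O u v = gen O v (π • u') ∧
      gen O a' b = gen O u' v := by
  have hua : u ∈ gen O a (π • b) := by rw [← hT]; exact left_mem_gen _ _
  have hva : π • v ∈ gen O a (π • b) := by rw [← hT]; exact right_mem_gen _ _
  have hau : a ∈ gen O u (π • v) := by rw [hT]; exact left_mem_gen _ _
  have hbu : π • b ∈ gen O u (π • v) := by rw [hT]; exact right_mem_gen _ _
  have hle : ∀ x y : S, gen O x (π • y) ≤ gen O x y := fun x y =>
    gen_le (left_mem_gen _ _) (Subalgebra.smul_mem _ (right_mem_gen _ _) _)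
  by_cases ha : (map ε a).totalDegree = 0
  · right
    have hu := D.const_of a b u ha hua
    obtain ⟨c, a', rfl⟩ := D.split a ha
    obtain ⟨c', u', rfl⟩ := D.split u hu
    refine ⟨a', u', ?_, ?_, ?_⟩
    · rw [gen_addC, gen_swap]
    · rw [gen_addC, gen_swap]
    · rw [gen_addC, gen_addC] at hT
      exact le_antisymm (D.scale _ _ _ _ hT.ge) (D.scale _ _ _ _ hT.le)
  · left
    have hu : (map ε u).totalDegree ≠ 0 := fun h => ha (D.const_of u v a h hau)
    apply le_antisymm
    · exact gen_le (hle _ _ hua) (D.claim1 a b v (by omega) hva)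
    · exact gen_le (hle _ _ hau) (D.claim1 u v b (by omega) hbu)

lemma DV.division (D : DV ε π) (N : ℕ) : ∀ u v : S, MM π (N + 1) (gen O u (π • v)) → MM π N (gen O u v) := by
  induction N with
  | zero =>
    rintro u v ⟨a, b, hT, hM⟩
    rcases D.div_aux a b u v hT with h | ⟨a', u', h1, h2, h3⟩
    · rw [h]; exact hM
    · exact absurd (h1.symm.trans hM) (D.not_top _ _)
  | succ N ih =>
    rintro u v ⟨a, b, hT, hM⟩
    rcases D.div_aux a b u v hT with h | ⟨a', u', h1, h2, h3⟩
    · rw [h]; exact hM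
    · rw [h1] at hM
      have := ih _ _ hM
      rw [gen_swap, h3, gen_swap] at this
      exact ⟨v, u', h2, this⟩

lemma DV.div_pow (D : DV ε π) (e : ℕ) : ∀ (N : ℕ) (u v : S), MM π N (gen O u (π ^ e • v)) →
    ∃ N', MM π N' (gen O u v) := by
  induction e with
  | zero => intro N u v h; exact ⟨N, by simpa using h⟩
  | succ e ih =>
    intro N u v h
    rw [pow_succ', mul_smul] at h
    cases N with
    | zero => exact absurd h (D.not_top _ _)
    | succ N => exact ih N u v (D.division N _ _ h)

lemma mul_pow' (e : ℕ) : ∀ (N : ℕ) (u v : S), MM π N (gen O u v) →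
    ∃ N', MM π N' (gen O u (π ^ e • v)) := by
  induction e with
  | zero => intro N u v h; exact ⟨N, by simpa using h⟩
  | succ e ih =>
    intro N u v h
    obtain ⟨N', h'⟩ := ih N u v h
    rw [pow_succ', mul_smul]
    exact ⟨N' + 1, _, _, rfl, h'⟩

lemma DV.smul_iff (D : DV ε π) {d : O} (hd : d ≠ 0) (u v : S) :
    (∃ N, MM π N (gen O (d • u) v)) ↔ ∃ N, MM π N (gen O u v) := by
  obtain ⟨w, e, rfl⟩ := D.fac d hd
  rw [mul_smul, gen_unit, gen_swap, gen_swap u v]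
  constructor
  · rintro ⟨N, h⟩; exact D.div_pow e N _ _ h
  · rintro ⟨N, h⟩; exact mul_pow' e N _ _ h

variable [CharZero O]

lemma DV.all (D : DV ε π) : ∀ u v : S, GP u v → ∃ N, MM π N (gen O u v) := by
  apply jungInd
  · intro a b c p ha hb
    rw [gen_swap, gen_addC, ← smul_eq_C_mul, D.smul_iff hb, gen_swap, gen_add, ← smul_eq_C_mul,
      D.smul_iff ha]
    · exact ⟨0, gen_X⟩
    · rw [Algebra.adjoin_singleton_eq_range_aeval]
      exact ⟨p, rfl⟩
  · intro u v _ h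
    rwa [gen_swap]
  · intro u v a b k hb _ _ h
    rw [gen_add, ← smul_eq_C_mul, D.smul_iff hb] at h
    · exact h
    · rw [← smul_eq_C_mul]
      exact Subalgebra.smul_mem _ (Subalgebra.pow_mem _ (Algebra.self_mem_adjoin_singleton O v) _) _

lemma map_aeval2 {R k : Type*} [CommRing R] [CommRing k] (ε : R →+* k) (u v H : MvPolynomial (Fin 2) R) :
    map ε (aeval ![u, v] H) = aeval ![map ε u, map ε v] (map ε H) := by
  rw [aeval_def, eval₂_comp_left (map ε : MvPolynomial (Fin 2) R →+* _), aeval_def, eval₂_map]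
  congr 1
  · ext r; simp [algebraMap_eq]
  · ext i; fin_cases i <;> simp

theorem DV.main (D : DV ε π) (u v : S) (h : GP u v) :
    gen O u v = ⊤ ∨ ∃ ψ φ : MvPolynomial (Fin 2) k, gen k ψ φ = ⊤ ∧ aeval ![map ε u, map ε v] φ = 0 := by
  obtain ⟨N, hN⟩ := D.all u v h
  cases N with
  | zero => left; exact hN
  | succ N =>
    right
    obtain ⟨a, b, hT, _⟩ := hN
    have ha : a ∈ gen O u v := by rw [hT]; exact left_mem_gen _ _
    have hb : π • b ∈ gen O u v := by rw [hT]; exact right_mem_gen _ _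
    have hu : u ∈ gen O a (π • b) := by rw [← hT]; exact left_mem_gen _ _
    have hv : v ∈ gen O a (π • b) := by rw [← hT]; exact right_mem_gen _ _
    obtain ⟨A, hA⟩ := ha
    obtain ⟨E, hE⟩ := hb
    obtain ⟨P, hP⟩ := hu
    obtain ⟨Q, hQ⟩ := hv
    have hA : aeval ![u, v] A = a := hA
    have hE : aeval ![u, v] E = π • b := hE
    have hP : aeval ![a, π • b] P = u := hP
    have hQ : aeval ![a, π • b] Q = v := hQ
    have comp : ∀ F : S, aeval ![u, v] (aeval ![A, E] F) = aeval ![a, π • b] F := by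
      intro F
      rw [← AlgHom.comp_apply, comp_aeval]
      congr 2
      ext1 i; fin_cases i
      · exact hA
      · exact hE
    have e0 : aeval ![A, E] P = X 0 := by
      apply alg_indep (GP_jac_ne h); rw [comp, hP]; simp
    have e1 : aeval ![A, E] Q = X 1 := by
      apply alg_indep (GP_jac_ne h); rw [comp, hQ]; simp
    refine ⟨map ε A, map ε E, ?_, ?_⟩
    · apply top_of_X
      · exact mem_gen.2 ⟨map ε P, by rw [← map_aeval2, e0, map_X]⟩
      · exact mem_gen.2 ⟨map ε Q, by rw [← map_aeval2, e1, map_X]⟩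
    · rw [← map_aeval2, hE, D.map_smul]

end dvr
end RealForm

set_option linter.unusedSectionVars false
open MvPolynomial

namespace RealForm

local notation "RR" => Polynomial ℂ
local notation "BB" => MvPolynomial (Fin 2) (Polynomial ℂ)
local notation "BC" => MvPolynomial (Fin 2) ℂ

/-- Taylor expansion at `p` -/
noncomputable def th' (p : ℂ) : RR →+* PowerSeries ℂ :=
  (Polynomial.coeToPowerSeries.ringHom).comp (Polynomial.taylorAlgHom p).toRingHom

lemma th'_inj (p : ℂ) : Function.Injective (th' p) := by
  intro a b h
  exact Polynomial.taylor_injective p (Polynomial.coe_injective ℂ h)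

lemma eps_th' (p : ℂ) (f : RR) : PowerSeries.constantCoeff (th' p f) = f.eval p := by
  change PowerSeries.constantCoeff ((Polynomial.taylor p f : RR) : PowerSeries ℂ) = _
  rw [Polynomial.constantCoeff_coe, Polynomial.taylor_coeff_zero]

lemma th'_X (p : ℂ) : th' p (Polynomial.X - Polynomial.C p) = PowerSeries.X := by
  change ((Polynomial.taylor p (Polynomial.X - Polynomial.C p) : RR) : PowerSeries ℂ) = _
  simp

lemma DVps : DV (PowerSeries.constantCoeff (R := ℂ)) (PowerSeries.X : PowerSeries ℂ) where
  surj := PowerSeries.constantCoeff_surj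
  ker c := (PowerSeries.X_dvd_iff).symm
  ne := PowerSeries.X_ne_zero
  fac b hb := by
    obtain ⟨n, u, h⟩ := IsDiscreteValuationRing.eq_unit_mul_pow_irreducible hb
      (PowerSeries.X_irreducible (R := ℂ))
    exact ⟨u, n, h⟩

/-- evaluation of `z` at `p` -/
noncomputable def ev (p : ℂ) : BB →+* BC := map (Polynomial.evalRingHom p)

lemma ev_zero (p : ℂ) (f : BB) : ev p f = 0 ↔ ∃ g, f = C (Polynomial.X - Polynomial.C p) * g := by
  constructor
  · intro h
    have : C (Polynomial.X - Polynomial.C p) ∣ f := by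
      rw [C_dvd_iff_dvd_coeff]
      intro i
      rw [Polynomial.dvd_iff_isRoot]
      have := congrArg (coeff i) h
      rw [ev, coeff_map, coeff_zero] at this
      exact this
    exact this
  · rintro ⟨g, rfl⟩
    simp [ev]

lemma ev_aeval (p : ℂ) (u v H : BB) : ev p (aeval ![u, v] H) = aeval ![ev p u, ev p v] (ev p H) :=
  map_aeval2 _ u v H

lemma GP_map {R R' : Type*} [CommRing R] [IsDomain R] [CommRing R'] [IsDomain R'] (θ : R →+* R')
    (hθ : Function.Injective θ) (u v : MvPolynomial (Fin 2) R) (h : GP u v) : GP (map θ u) (map θ v) := by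
  have : ∀ i, X i ∈ sat (gen R' (map θ u) (map θ v)) := by
    intro i
    obtain ⟨d, hd, H, hH⟩ := GP_exists h i
    refine mem_sat.2 ⟨θ d, by rwa [Ne, map_eq_zero_iff θ hθ], mem_gen.2 ⟨map θ H, ?_⟩⟩
    rw [← map_aeval2, hH, smul_eq_C_mul]; simp
  exact top_of_X (this 0) (this 1)

instance charZero_ps : CharZero (PowerSeries ℂ) :=
  charZero_of_injective_ringHom (f := PowerSeries.C) PowerSeries.C_injective

lemma loc (p : ℂ) (u v f : BB) (h : GP u v) (h1 : (Polynomial.X - Polynomial.C p) • f ∈ gen RR u v)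
    (h2 : f ∉ gen RR u v) :
    ∃ ψ φ : BC, gen ℂ ψ φ = ⊤ ∧ aeval ![ev p u, ev p v] φ = 0 := by
  have hg := GP_map (th' p) (th'_inj p) u v h
  have hev : ∀ w : BB, map (PowerSeries.constantCoeff (R := ℂ)) (map (th' p) w) = ev p w := by
    intro w
    have e : (PowerSeries.constantCoeff (R := ℂ)).comp (th' p) = Polynomial.evalRingHom p :=
      RingHom.ext fun r => eps_th' p r
    rw [map_map, e, ev]
  rcases DVps.main _ _ hg with htop | ⟨ψ, φ, hψ, hφ⟩
  · exfalso
    apply h2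
    obtain ⟨H, hH⟩ := mem_gen.1 h1
    have : map (th' p) f ∈ gen (PowerSeries ℂ) (map (th' p) u) (map (th' p) v) := by rw [htop]; trivial
    obtain ⟨G, hG⟩ := mem_gen.1 this
    have e : map (th' p) H = C PowerSeries.X * G := by
      apply alg_indep (GP_jac_ne hg)
      rw [← map_aeval2, hH, map_mul, hG, smul_eq_C_mul, map_mul, map_C, th'_X, aeval_C, algebraMap_eq]
    have e2 : ev p H = 0 := by
      rw [← hev, e]; simp
    obtain ⟨H', rfl⟩ := (ev_zero p H).1 e2
    refine mem_gen.2 ⟨H', ?_⟩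
    rw [map_mul, aeval_C, algebraMap_eq, smul_eq_C_mul] at hH
    exact mul_left_cancel₀ (by rw [Ne, C_eq_zero]; exact Polynomial.X_sub_C_ne_zero p) hH
  · rw [hev, hev] at hφ
    exact ⟨ψ, φ, hψ, hφ⟩

lemma find_aux (T : Subalgebra RR BB) (n : ℕ) : ∀ (d : RR) (f : BB), d.natDegree = n → d ≠ 0 → d • f ∈ T → f ∉ T →
    ∃ (p : ℂ) (g : BB), (Polynomial.X - Polynomial.C p) • g ∈ T ∧ g ∉ T := by
  induction n with
  | zero =>
    intro d f hn hd h1 h2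
    exfalso
    apply h2
    rw [Polynomial.eq_C_of_natDegree_eq_zero hn] at h1 hd
    have hc : d.coeff 0 ≠ 0 := by simpa using hd
    have := T.smul_mem h1 (Polynomial.C (d.coeff 0)⁻¹)
    rwa [smul_smul, ← Polynomial.C_mul, inv_mul_cancel₀ hc, Polynomial.C_1, one_smul] at this
  | succ n ih =>
    intro d f hn hd h1 h2
    obtain ⟨p, hp⟩ := IsAlgClosed.exists_root d (by
      rw [Polynomial.degree_eq_natDegree hd, hn]; exact_mod_cast Nat.succ_ne_zero n)
    obtain ⟨d', rfl⟩ := Polynomial.dvd_iff_isRoot.2 hp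
    rw [mul_smul] at h1
    by_cases h3 : d' • f ∈ T
    · have hd' : d' ≠ 0 := right_ne_zero_of_mul hd
      rw [Polynomial.natDegree_mul (Polynomial.X_sub_C_ne_zero p) hd', Polynomial.natDegree_X_sub_C] at hn
      exact ih d' f (by omega) hd' h3 h2
    · exact ⟨p, _, h1, h3⟩

lemma find (u v : BB) (h : GP u v) (hne : gen RR u v ≠ ⊤) :
    ∃ (p : ℂ) (ψ φ : BC), gen ℂ ψ φ = ⊤ ∧ aeval ![ev p u, ev p v] φ = 0 := by
  obtain ⟨f, hf⟩ : ∃ f, f ∉ gen RR u v := by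
    by_contra hcon
    push Not at hcon
    exact hne (eq_top_iff.2 fun x _ => hcon x)
  have : f ∈ sat (gen RR u v) := by rw [h]; trivial
  obtain ⟨d, hd, hdf⟩ := this
  obtain ⟨p, g, h1, h2⟩ := find_aux _ _ d f rfl hd hdf hf
  exact ⟨p, loc p u v g h h1 h2⟩

/-- conjugation on `ℂ[z]` -/
noncomputable def sR : RR →+* RR := Polynomial.mapRingHom (starRingEnd ℂ)

lemma real_lift (p : ℂ) (hp : p.im ≠ 0) (c : ℂ) : ∃ r : RR, sR r = r ∧ r.eval p = c := by
  refine ⟨Polynomial.C ((c.re - c.im / p.im * p.re : ℝ) : ℂ) +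
    Polynomial.C ((c.im / p.im : ℝ) : ℂ) * Polynomial.X, ?_, ?_⟩
  · simp only [sR, Polynomial.coe_mapRingHom, Polynomial.map_add, Polynomial.map_mul, Polynomial.map_C,
      Polynomial.map_X, Complex.conj_ofReal]
  · apply Complex.ext
    · simp
    · simp; field_simp

lemma lift_nonreal (p : ℂ) (hp : p.im ≠ 0) : ∀ ψ φ : BC, GP ψ φ → ∃ (Ψ Φ : BB) (α β : ℂ), α ≠ 0 ∧ β ≠ 0 ∧
    map sR Ψ = Ψ ∧ map sR Φ = Φ ∧ gen RR Ψ Φ = ⊤ ∧ ev p Ψ = C α * ψ ∧ ev p Φ = C β * φ := by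
  choose L hL1 hL2 using real_lift p hp
  apply jungInd
  · intro a b c q ha hb
    set Q : Polynomial RR := ∑ i ∈ Finset.range (q.natDegree + 1), Polynomial.monomial i (L (a⁻¹ * q.coeff i))
      with hQ
    have hQX : Polynomial.aeval (X 1 : BB) Q =
        ∑ i ∈ Finset.range (q.natDegree + 1), C (L (a⁻¹ * q.coeff i)) * X 1 ^ i := by
      rw [hQ, map_sum]
      exact Finset.sum_congr rfl fun i _ => by rw [Polynomial.aeval_monomial, algebraMap_eq]
    refine ⟨X 0 + Polynomial.aeval (X 1) Q, X 1 + C (L (b⁻¹ * c)), a⁻¹, b⁻¹, inv_ne_zero ha,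
      inv_ne_zero hb, ?_, ?_, ?_, ?_, ?_⟩
    · rw [hQX]
      simp [hL1]
    · simp [hL1]
    · rw [gen_swap, gen_addC, gen_swap, gen_add]
      · exact gen_X
      · rw [Algebra.adjoin_singleton_eq_range_aeval]
        exact ⟨Q, rfl⟩
    · rw [hQX, ev, Polynomial.aeval_eq_sum_range]
      simp only [map_add, map_sum, map_mul, map_C, map_pow, map_X, Polynomial.coe_evalRingHom, hL2,
        mul_add, Finset.mul_sum, smul_eq_C_mul]
      have : (C a⁻¹ * C a : BC) = 1 := by rw [← C_mul, inv_mul_cancel₀ ha, C_1]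
      rw [← mul_assoc, this, one_mul]
      congr 1
      exact Finset.sum_congr rfl fun i _ => by ring
    · have : (C b⁻¹ * C b : BC) = 1 := by rw [← C_mul, inv_mul_cancel₀ hb, C_1]
      simp only [ev, map_add, map_C, map_X, Polynomial.coe_evalRingHom, hL2, C_mul]
      linear_combination - X 1 * this
  · rintro ψ φ _ ⟨Ψ, Φ, α, β, hα, hβ, h1, h2, h3, h4, h5⟩
    exact ⟨Φ, Ψ, β, α, hβ, hα, h2, h1, by rw [gen_swap]; exact h3, h5, h4⟩
  · rintro ψ φ a b k hb _ _ ⟨Ψ, Φ, α, β, hα, hβ, h1, h2, h3, h4, h5⟩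
    refine ⟨Ψ + C (- L (α * a * (β ^ k)⁻¹)) * Φ ^ k, Φ, α * b, β, mul_ne_zero hα hb, hβ, ?_, h2, ?_, ?_, h5⟩
    · simp [h1, h2, hL1]
    · rw [gen_add, h3]
      rw [← smul_eq_C_mul]
      exact Subalgebra.smul_mem _ (Subalgebra.pow_mem _ (Algebra.self_mem_adjoin_singleton _ _) _) _
    · have e1 : ev p (C (- L (α * a * (β ^ k)⁻¹))) = - C (α * a * (β ^ k)⁻¹) := by
        simp only [ev, map_C, map_neg, Polynomial.coe_evalRingHom, hL2]
      have e2 : (C (β ^ k)⁻¹ * C β ^ k : BC) = 1 := by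
        rw [← C_pow, ← C_mul, inv_mul_cancel₀ (pow_ne_zero _ hβ), C_1]
      rw [map_add, map_mul, map_pow, h4, h5, e1, C_mul, C_mul, C_mul, mul_pow]
      linear_combination - C α * C a * φ ^ k * e2

end RealForm

set_option linter.unusedSectionVars false
open MvPolynomial

namespace RealForm

/-- conjugation on `ℂ[x,y]` -/
noncomputable def sC : MvPolynomial (Fin 2) ℂ →+* MvPolynomial (Fin 2) ℂ := map (starRingEnd ℂ)

lemma sC_sC (f : MvPolynomial (Fin 2) ℂ) : sC (sC f) = f := by
  rw [sC, map_map]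
  have : (starRingEnd ℂ).comp (starRingEnd ℂ) = RingHom.id ℂ := by ext; simp
  rw [this, map_id]

lemma sC_C (c : ℂ) : sC (C c) = C (starRingEnd ℂ c) := by simp [sC]

lemma sC_jac (f g : MvPolynomial (Fin 2) ℂ) : sC (jac f g) = jac (sC f) (sC g) := by
  simp only [jac, sC, map_sub, map_mul, pderiv_map]

lemma jac_const {ψ φ : MvPolynomial (Fin 2) ℂ} (h : gen ℂ ψ φ = ⊤) : ∃ j : ℂ, j ≠ 0 ∧ jac ψ φ = C j := by
  have hg : GP ψ φ := eq_top_iff.2 (by rw [← h]; exact le_sat _)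
  obtain ⟨d, hd, hdv⟩ := GP_jac hg
  have : IsUnit (jac ψ φ) := isUnit_of_dvd_unit hdv ((IsUnit.mk0 d hd).map C)
  obtain ⟨r, hr, e⟩ := isUnit_iff_eq_C_of_isReduced.1 this
  exact ⟨r, hr.ne_zero, e⟩

lemma gen_scal {ψ φ : MvPolynomial (Fin 2) ℂ} (c : ℂ) (hc : c ≠ 0) (h : gen ℂ ψ φ = ⊤) : gen ℂ (C c * ψ) φ = ⊤ := by
  have := gen_unit (Units.mk0 c hc) ψ φ
  rw [Units.val_mk0, smul_eq_C_mul] at this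
  rw [this, h]

lemma gen_of_jac {ψ φ ψ' : MvPolynomial (Fin 2) ℂ} (h : gen ℂ ψ φ = ⊤) (j' : ℂ) (hj' : j' ≠ 0)
    (hj : jac ψ' φ = C j') : gen ℂ ψ' φ = ⊤ := by
  obtain ⟨j, hj0, e⟩ := jac_const h
  have hne : jac ψ φ ≠ 0 := by rw [e]; simpa using hj0
  have hm : ψ' ∈ gen ℂ ψ φ := by rw [h]; trivial
  obtain ⟨H, rfl⟩ := mem_gen.1 hm
  have e1 := jac_aeval ![ψ, φ] H (X 1)
  have f0 : jac H (X 1) = pderiv 0 H := by simp [jac, pderiv_X]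
  simp only [aeval_X, Matrix.cons_val_zero, Matrix.cons_val_one, f0] at e1
  rw [hj, e] at e1
  have e2 : pderiv 0 H = C (j' / j) := by
    apply alg_indep hne
    have : (C j : MvPolynomial (Fin 2) ℂ) ≠ 0 := by simpa using hj0
    apply mul_right_cancel₀ this
    rw [← e1, aeval_C, algebraMap_eq, ← C_mul, div_mul_cancel₀ _ hj0]
  obtain ⟨p, hp⟩ := of_deg_y (H - C (j' / j) * X 0) (by
    intro d hd
    by_contra h0
    have h1 : pderiv 0 (H - C (j' / j) * X 0) = 0 := by
      rw [map_sub, e2, pderiv_C_mul, pderiv_X_self, mul_one, sub_self]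
    have h2 := coeff_pderiv (i := 0) (p := H - C (j' / j) * X 0) (d - Finsupp.single 0 1)
    rw [h1, coeff_zero, tsub_add_cancel_of_le (by simpa using Nat.one_le_iff_ne_zero.2 h0)] at h2
    rcases mul_eq_zero.1 h2.symm with h3 | h3
    · exact mem_support_iff.1 hd h3
    · exact absurd h3 (Nat.cast_add_one_ne_zero _))
  have hH : H = C (j' / j) * X 0 + Polynomial.aeval (X 1) p := by rw [← hp]; ring
  have : aeval ![ψ, φ] H = C (j' / j) * ψ + Polynomial.aeval φ p := by
    rw [hH, map_add, map_mul, aeval_C, algebraMap_eq, aeval_X, ← Polynomial.aeval_algHom_apply, aeval_X]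
    rfl
  rw [this, gen_add]
  · exact gen_scal _ (div_ne_zero hj' hj0) h
  · rw [Algebra.adjoin_singleton_eq_range_aeval]
    exact ⟨p, rfl⟩

lemma real_coord {ψ φ u v : MvPolynomial (Fin 2) ℂ} (h : gen ℂ ψ φ = ⊤) (h1 : aeval ![u, v] φ = 0)
    (h2 : aeval ![u, v] (sC φ) = 0) (h3 : 1 ≤ (aeval ![u, v] ψ).totalDegree) :
    ∃ ψ' φ', sC ψ' = ψ' ∧ sC φ' = φ' ∧ gen ℂ ψ' φ' = ⊤ ∧ aeval ![u, v] φ' = 0 := by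
  obtain ⟨j, hj0, ej⟩ := jac_const h
  have hφ : φ ≠ 0 := by
    rintro rfl
    simp [jac] at ej
    exact hj0 (C_eq_zero.1 ej.symm)
  have hdvd : φ ∣ sC φ := by
    have hm : sC φ ∈ gen ℂ ψ φ := by rw [h]; trivial
    obtain ⟨H, hH⟩ := mem_gen.1 hm
    have k : ∀ a : MvPolynomial (Fin 2) ℂ, Polynomial.aeval a (aeval ![(Polynomial.X : Polynomial ℂ), 0] H) = aeval ![a, 0] H := by
      intro a
      rw [← AlgHom.comp_apply, comp_aeval]
      congr 2
      ext i; fin_cases i <;> simp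
    have z : aeval ![(Polynomial.X : Polynomial ℂ), 0] H = 0 := by
      apply transc h3
      refine Eq.trans ?_ h2
      rw [k, ← hH, ← AlgHom.comp_apply, comp_aeval]
      congr 2
      funext i
      fin_cases i
      · rfl
      · exact h1.symm
    have k2 := k ψ
    rw [z, map_zero] at k2
    rw [← Ideal.mem_span_singleton, ← Ideal.Quotient.eq_zero_iff_mem, ← hH]
    change Ideal.Quotient.mkₐ ℂ (Ideal.span {φ}) _ = 0
    rw [← map_zero (Ideal.Quotient.mkₐ ℂ (Ideal.span {φ})), k2, ← AlgHom.comp_apply, ← AlgHom.comp_apply,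
      comp_aeval, comp_aeval]
    congr 2
    ext i
    fin_cases i
    · simp
    · simp only [Fin.mk_one, Matrix.cons_val_one]
      exact Ideal.Quotient.eq_zero_iff_mem.2 (Ideal.mem_span_singleton_self _)
  obtain ⟨w, hw⟩ := hdvd
  have hw2 : w * sC w = 1 := by
    have := congrArg sC hw
    rw [sC_sC, map_mul, hw] at this
    apply mul_left_cancel₀ hφ
    rw [mul_one, ← mul_assoc, ← this]
  obtain ⟨c, hc, rfl⟩ := isUnit_iff_eq_C_of_isReduced.1 (IsUnit.of_mul_eq_one _ hw2)
  obtain ⟨e, he, her⟩ : ∃ e : ℂ, e ≠ 0 ∧ sC (C e * φ) = C e * φ := by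
    by_cases h4 : 1 + c = 0
    · refine ⟨Complex.I, Complex.I_ne_zero, ?_⟩
      rw [map_mul, hw, sC_C, Complex.conj_I, eq_neg_of_add_eq_zero_right h4]
      simp
    · refine ⟨1 + c, h4, ?_⟩
      have : C (1 + c) * φ = φ + sC φ := by rw [hw, C_add, C_1]; ring
      rw [this, map_add, sC_sC, add_comm]
  have h' : gen ℂ ψ (C e * φ) = ⊤ := by
    rw [gen_swap]; apply gen_scal e he; rw [gen_swap]; exact h
  obtain ⟨j, hj0, ej⟩ := jac_const h'
  have ej2 : jac (sC ψ) (C e * φ) = C (starRingEnd ℂ j) := by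
    rw [← her, ← sC_jac, ej, sC_C]
  have hadd : ∀ a b c : MvPolynomial (Fin 2) ℂ, jac (a + b) c = jac a c + jac b c := by
    intro a b c; simp [jac]; ring
  have hmul : ∀ (t : ℂ) (a c : MvPolynomial (Fin 2) ℂ), jac (C t * a) c = C t * jac a c := by
    intro t a c; simp only [jac, pderiv_C_mul]; ring
  have hz : aeval ![u, v] (C e * φ) = 0 := by rw [map_mul, h1, mul_zero]
  by_cases h5 : j + starRingEnd ℂ j = 0
  · refine ⟨C Complex.I * (ψ + C (-1) * sC ψ), C e * φ, ?_, her, ?_, hz⟩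
    · simp only [map_mul, map_add, sC_C, sC_sC, Complex.conj_I]
      simp; ring
    · refine gen_of_jac h' (Complex.I * (2 * j)) (by simp [hj0]) ?_
      rw [hmul, hadd, hmul, ej, ej2, ← C_mul, ← C_add, ← C_mul]
      congr 2
      linear_combination -h5
  · refine ⟨ψ + sC ψ, C e * φ, ?_, her, ?_, hz⟩
    · rw [map_add, sC_sC, add_comm]
    · refine gen_of_jac h' _ h5 ?_
      rw [hadd, ej, ej2, C_add]

end RealForm

set_option linter.unusedSectionVars false
open MvPolynomial

namespace RealForm

lemma sR_X_sub (p : ℂ) : sR (Polynomial.X - Polynomial.C p) = Polynomial.X - Polynomial.C (starRingEnd ℂ p) := by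
  simp [sR]

lemma sR_sR (r : Polynomial ℂ) : sR (sR r) = r := by
  simp only [sR, Polynomial.coe_mapRingHom, Polynomial.map_map]
  have : (starRingEnd ℂ).comp (starRingEnd ℂ) = RingHom.id ℂ := by ext; simp
  rw [this, Polynomial.map_id]

lemma cst_sR (f : MvPolynomial (Fin 2) ℂ) : map sR (map Polynomial.C f) = map Polynomial.C (sC f) := by
  rw [sC, map_map, map_map]
  congr 2
  ext; simp [sR]

lemma cst_ev (p : ℂ) (f : MvPolynomial (Fin 2) ℂ) : ev p (map Polynomial.C f) = f := by
  rw [ev, map_map]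
  have : (Polynomial.evalRingHom p).comp Polynomial.C = RingHom.id ℂ := by ext; simp
  rw [this, map_id]

section
variable (τ : MvPolynomial (Fin 2) (Polynomial ℂ) →+* MvPolynomial (Fin 2) (Polynomial ℂ))
  (hτC : ∀ r, τ (C r) = C (sR r))
  {u v : MvPolynomial (Fin 2) (Polynomial ℂ)} (hu : τ u = u) (hv : τ v = v)

lemma tau_aeval (hτC : ∀ r, τ (C r) = C (sR r)) (hu : τ u = u) (hv : τ v = v)
    (H : MvPolynomial (Fin 2) (Polynomial ℂ)) : τ (aeval ![u, v] H) = aeval ![u, v] (map sR H) := by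
  rw [aeval_def, eval₂_comp_left, aeval_def, eval₂_map]
  congr 1
  · ext r <;> simp [algebraMap_eq, hτC]
  · ext i; fin_cases i <;> simp [hu, hv]

lemma ev_cst (p : ℂ) (f : MvPolynomial (Fin 2) ℂ) :
    ev p (aeval ![u, v] (map Polynomial.C f)) = aeval ![ev p u, ev p v] f := by
  rw [ev_aeval, cst_ev]

lemma conj_van (hτC : ∀ r, τ (C r) = C (sR r)) (hu : τ u = u) (hv : τ v = v) (p : ℂ)
    (hp : starRingEnd ℂ p = p) (f : MvPolynomial (Fin 2) ℂ)
    (h : aeval ![ev p u, ev p v] f = 0) : aeval ![ev p u, ev p v] (sC f) = 0 := by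
  rw [← ev_cst] at h ⊢
  obtain ⟨g, hg⟩ := (ev_zero _ _).1 h
  have := congrArg τ hg
  rw [tau_aeval τ hτC hu hv, cst_sR, map_mul, hτC, sR_X_sub, hp] at this
  exact (ev_zero _ _).2 ⟨_, this⟩

lemma real_case (hτC : ∀ r, τ (C r) = C (sR r)) (hu : τ u = u) (hv : τ v = v) (p : ℂ)
    (hp : starRingEnd ℂ p = p) (ψ φ : MvPolynomial (Fin 2) ℂ) (hg : gen ℂ ψ φ = ⊤)
    (h : aeval ![ev p u, ev p v] φ = 0) :
    ∃ ψ' φ', sC ψ' = ψ' ∧ sC φ' = φ' ∧ gen ℂ ψ' φ' = ⊤ ∧ aeval ![ev p u, ev p v] φ' = 0 := by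
  rcases Nat.eq_zero_or_pos (aeval ![ev p u, ev p v] ψ).totalDegree with h0 | h0
  · obtain ⟨c', hc'⟩ : ∃ c', aeval ![ev p u, ev p v] ψ = C c' := ⟨_, totalDegree_eq_zero_iff_eq_C.1 h0⟩
    have hm : X 0 ∈ gen ℂ ψ φ := by rw [hg]; trivial
    obtain ⟨H, hH⟩ := mem_gen.1 hm
    obtain ⟨c, hc⟩ : ∃ c, ev p u = C c := by
      refine ⟨aeval ![c', 0] H, ?_⟩
      have e : ev p u = aeval ![ev p u, ev p v] (X 0 : MvPolynomial (Fin 2) ℂ) := by simp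
      rw [e, ← hH, ← AlgHom.comp_apply, comp_aeval, ← algebraMap_eq, ← aeval_algebraMap_apply]
      congr 2
      funext i
      fin_cases i
      · exact hc'
      · exact h.trans (by simp)
    have e1 : aeval ![ev p u, ev p v] (X 0 - C c : MvPolynomial (Fin 2) ℂ) = 0 := by
      simp [hc, algebraMap_eq]
    have e2 := conj_van τ hτC hu hv p hp _ e1
    have e3 : starRingEnd ℂ c = c := by
      rw [map_sub, sC_C] at e2
      simp only [sC, map_X, map_sub, aeval_X, aeval_C, Matrix.cons_val_zero, hc, algebraMap_eq] at e2
      rw [← C_sub, C_eq_zero, sub_eq_zero] at e2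
      exact e2.symm
    refine ⟨X 1, X 0 - C c, by simp [sC], ?_, ?_, e1⟩
    · rw [map_sub, sC_C, e3]; simp [sC]
    · rw [gen_swap, sub_eq_add_neg, ← C_neg, gen_add]
      · exact gen_X
      · rw [← algebraMap_eq]; exact Subalgebra.algebraMap_mem _ _
  · exact real_coord hg h (conj_van τ hτC hu hv p hp _ h) h0

lemma step (hτC : ∀ r, τ (C r) = C (sR r)) (hu : τ u = u) (hv : τ v = v) (hG : GP u v)
    (hne : gen (Polynomial ℂ) u v ≠ ⊤) :
    ∃ (Ψ Φ g : MvPolynomial (Fin 2) (Polynomial ℂ)) (q : Polynomial ℂ), map sR Ψ = Ψ ∧ map sR Φ = Φ ∧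
      gen (Polynomial ℂ) Ψ Φ = ⊤ ∧ sR q = q ∧ q ≠ 0 ∧ ¬ IsUnit q ∧ aeval ![u, v] Φ = C q * g := by
  obtain ⟨p, ψ, φ, hg, h⟩ := find u v hG hne
  by_cases hp : p.im = 0
  · have hp' := Complex.conj_eq_iff_im.2 hp
    obtain ⟨ψ', φ', h1, h2, h3, h4⟩ := real_case τ hτC hu hv p hp' ψ φ hg h
    rw [← ev_cst] at h4
    obtain ⟨g, hg⟩ := (ev_zero _ _).1 h4
    refine ⟨map Polynomial.C ψ', map Polynomial.C φ', g, Polynomial.X - Polynomial.C p, ?_, ?_, ?_, ?_,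
      Polynomial.X_sub_C_ne_zero p, Polynomial.not_isUnit_X_sub_C p, hg⟩
    · rw [cst_sR, h1]
    · rw [cst_sR, h2]
    · have : ∀ i, X i ∈ gen (Polynomial ℂ) (map Polynomial.C ψ') (map Polynomial.C φ') := by
        intro i
        have hm : X i ∈ gen ℂ ψ' φ' := by rw [h3]; trivial
        obtain ⟨H, hH⟩ := mem_gen.1 hm
        refine mem_gen.2 ⟨map Polynomial.C H, ?_⟩
        rw [← map_aeval2, hH, map_X]
      exact top_of_X (this 0) (this 1)
    · rw [sR_X_sub, hp']
  · obtain ⟨Ψ, Φ, α, β, hα, hβ, h1, h2, h3, h4, h5⟩ := lift_nonreal p hp ψ φ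
      (eq_top_iff.2 (by rw [← hg]; exact le_sat _))
    have e1 : ev p (aeval ![u, v] Φ) = 0 := by
      rw [ev_aeval, h5, map_mul, h, mul_zero]
    obtain ⟨g1, hg1⟩ := (ev_zero _ _).1 e1
    have e2 := congrArg τ hg1
    rw [tau_aeval τ hτC hu hv, h2, map_mul, hτC, sR_X_sub] at e2
    have e3 := (ev_zero _ _).2 ⟨_, e2⟩
    rw [hg1, map_mul] at e3
    have e4 : ev (starRingEnd ℂ p) g1 = 0 := by
      refine (mul_eq_zero.1 e3).resolve_left ?_
      simp only [ev, map_C, Polynomial.coe_evalRingHom, Polynomial.eval_sub, Polynomial.eval_X,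
        Polynomial.eval_C]
      rw [C_eq_zero, sub_eq_zero, Complex.conj_eq_iff_im]
      exact hp
    obtain ⟨g2, hg2⟩ := (ev_zero _ _).1 e4
    refine ⟨Ψ, Φ, g2, (Polynomial.X - Polynomial.C p) * (Polynomial.X - Polynomial.C (starRingEnd ℂ p)), h1, h2,
      h3, ?_, mul_ne_zero (Polynomial.X_sub_C_ne_zero _) (Polynomial.X_sub_C_ne_zero _), ?_, ?_⟩
    · rw [map_mul, sR_X_sub, sR_X_sub, Complex.conj_conj, mul_comm]
    · intro hU
      exact Polynomial.not_isUnit_X_sub_C p (isUnit_of_mul_isUnit_left hU)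
    · rw [hg1, hg2, C_mul]; ring

theorem descent (hτC : ∀ r, τ (C r) = C (sR r)) : ∀ (J u v : MvPolynomial (Fin 2) (Polynomial ℂ)), jac u v = J →
    τ u = u → τ v = v → GP u v → ∃ u' v', τ u' = u' ∧ τ v' = v' ∧ gen (Polynomial ℂ) u' v' = ⊤ := by
  intro J
  induction J using (wellFounded_dvdNotUnit (α := MvPolynomial (Fin 2) (Polynomial ℂ))).induction with
  | h J ih =>
  rintro u v rfl hu hv hG
  by_cases hne : gen (Polynomial ℂ) u v = ⊤
  · exact ⟨u, v, hu, hv, hne⟩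
  obtain ⟨Ψ, Φ, g, q, h1, h2, h3, h4, h5, h6, h7⟩ := step τ hτC hu hv hG hne
  have hCq : (C q : MvPolynomial (Fin 2) (Polynomial ℂ)) ≠ 0 := by rwa [Ne, C_eq_zero]
  have hX : ∀ i, ∃ F : MvPolynomial (Fin 2) (Polynomial ℂ), aeval ![Ψ, Φ] F = (X i : MvPolynomial (Fin 2) (Polynomial ℂ)) := by
    intro i
    have hm : X i ∈ gen (Polynomial ℂ) Ψ Φ := by rw [h3]; trivial
    exact mem_gen.1 hm
  have hmem : ∀ i, ![u, v] i ∈ gen (Polynomial ℂ) (aeval ![u, v] Ψ) g := by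
    intro i
    obtain ⟨F, hF⟩ := hX i
    have e : ![u, v] i ∈ gen (Polynomial ℂ) (aeval ![u, v] Ψ) (C q * g) := by
      refine mem_gen.2 ⟨F, ?_⟩
      have := congrArg (aeval ![u, v]) hF
      rw [aeval_X, ← AlgHom.comp_apply, comp_aeval] at this
      rw [← this, ← h7]
      congr 2
      ext i; fin_cases i <;> simp
    refine gen_le (left_mem_gen _ _) ?_ e
    rw [← smul_eq_C_mul]
    exact Subalgebra.smul_mem _ (right_mem_gen _ _) _
  have hG' : GP (aeval ![u, v] Ψ) g := GP_of_mem hG (le_sat _ (hmem 0)) (le_sat _ (hmem 1))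
  refine ih (jac (aeval ![u, v] Ψ) g) ?_ _ g rfl ?_ ?_ hG'
  · refine ⟨GP_jac_ne hG', ?_⟩
    obtain ⟨F, hF⟩ := hX 0
    obtain ⟨F', hF'⟩ := hX 1
    have e0 := jac_aeval ![Ψ, Φ] F F'
    rw [hF, hF'] at e0
    have e1 := jac_aeval ![u, v] Ψ Φ
    rw [h7] at e1
    simp only [Matrix.cons_val_zero, Matrix.cons_val_one] at e0 e1
    have e2 : jac (X 0) (X 1 : MvPolynomial (Fin 2) (Polynomial ℂ)) = 1 := by simp [jac, pderiv_X]
    rw [e2] at e0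
    have e3 := congrArg (aeval ![u, v]) e0
    rw [map_one, map_mul] at e3
    have e4 : jac (aeval ![u, v] Ψ) (C q * g) = C q * jac (aeval ![u, v] Ψ) g := by
      simp only [jac, pderiv_C_mul]; ring
    refine ⟨aeval ![u, v] (aeval ![Ψ, Φ] (jac F F')) * C q, ?_, ?_⟩
    · intro hU
      have := isUnit_of_mul_isUnit_right hU
      have := this.map (constantCoeff)
      rw [constantCoeff_C] at this
      exact h6 this
    · rw [e4] at e1
      linear_combination jac u v * e3 - aeval ![u, v] (aeval ![Ψ, Φ] (jac F F')) * e1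
  · rw [tau_aeval τ hτC hu hv, h1]
  · apply mul_left_cancel₀ hCq
    have := congrArg τ h7
    rw [tau_aeval τ hτC hu hv, h2, map_mul, hτC, h4, h7] at this
    exact this.symm

end

end RealForm

set_option linter.unusedSectionVars false
open MvPolynomial

namespace RealForm

lemma clear_den (u : MvPolynomial (Fin 2) (FractionRing (Polynomial ℂ))) : ∃ d : Polynomial ℂ, d ≠ 0 ∧ ∃ u0,
    C (algebraMap _ (FractionRing (Polynomial ℂ)) d) * u = map (algebraMap (Polynomial ℂ) _) u0 := by
  induction u using MvPolynomial.induction_on with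
  | C a =>
    obtain ⟨x, y, hy, rfl⟩ := IsFractionRing.div_surjective (A := Polynomial ℂ) a
    have hy0 := nonZeroDivisors.ne_zero hy
    refine ⟨y, hy0, C x, ?_⟩
    rw [map_C, ← C_mul, mul_div_cancel₀]
    rwa [Ne, FaithfulSMul.algebraMap_eq_zero_iff]
  | add p q hp hq =>
    obtain ⟨d, hd, p0, h1⟩ := hp
    obtain ⟨e, he, q0, h2⟩ := hq
    refine ⟨d * e, mul_ne_zero hd he, C e * p0 + C d * q0, ?_⟩
    simp only [map_add, map_mul, map_C]
    rw [← h1, ← h2]; ring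
  | mul_X p j hp =>
    obtain ⟨d, hd, p0, h1⟩ := hp
    refine ⟨d, hd, p0 * X j, ?_⟩
    rw [map_mul, map_X, ← h1]; ring

/-- conjugation on `ℂ[z]` as an equivalence -/
noncomputable def sE : Polynomial ℂ ≃+* Polynomial ℂ :=
  RingEquiv.ofRingHom sR sR (RingHom.ext sR_sR) (RingHom.ext sR_sR)

/-- conjugation on `ℂ(z)` -/
noncomputable def sK : FractionRing (Polynomial ℂ) ≃+* FractionRing (Polynomial ℂ) :=
  IsFractionRing.ringEquivOfRingEquiv sE

lemma sK_alg (r : Polynomial ℂ) : sK (algebraMap _ _ r) = algebraMap _ _ (sR r) :=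
  IsFractionRing.ringEquivOfRingEquiv_algebraMap sE r

lemma sK_sK (a : FractionRing (Polynomial ℂ)) : sK (sK a) = a := by
  obtain ⟨x, y, hy, rfl⟩ := IsFractionRing.div_surjective (A := Polynomial ℂ) a
  simp only [map_div₀, sK_alg, sR_sR]

lemma ext_hom (e : MvPolynomial (Fin 2) (Polynomial ℂ) →ₐ[Polynomial ℂ] MvPolynomial (Fin 2) (Polynomial ℂ))
    (P : MvPolynomial (Fin 2) (Polynomial ℂ)) :
    aeval (fun j => map (algebraMap (Polynomial ℂ) (FractionRing (Polynomial ℂ))) (e (X j)))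
      (map (algebraMap (Polynomial ℂ) (FractionRing (Polynomial ℂ))) P) =
    map (algebraMap (Polynomial ℂ) (FractionRing (Polynomial ℂ))) (e P) := by
  induction P using MvPolynomial.induction_on with
  | C a =>
    have : e (C a) = C a := by rw [← algebraMap_eq]; exact e.commutes a
    rw [this, map_C, aeval_C, algebraMap_eq]
  | add p q hp hq => simp only [map_add, hp, hq]
  | mul_X p j hp => simp only [map_mul, hp, map_X, aeval_X]

lemma fixed_pair (ν : MvPolynomial (Fin 2) (Polynomial ℂ) ≃ₐ[Polynomial ℂ] MvPolynomial (Fin 2) (Polynomial ℂ))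
    (hν : ∀ P, ν (map sR (ν (map sR P))) = P) :
    ∃ u v, ν (map sR u) = u ∧ ν (map sR v) = v ∧ GP u v := by
  set i := algebraMap (Polynomial ℂ) (FractionRing (Polynomial ℂ)) with hi
  have hinj : Function.Injective i := IsFractionRing.injective _ _
  have hminj : Function.Injective (map i : MvPolynomial (Fin 2) _ →+* _) := map_injective _ hinj
  have k1 := ext_hom (ν : MvPolynomial (Fin 2) (Polynomial ℂ) →ₐ[Polynomial ℂ] _)
  have k2 := ext_hom (ν.symm : MvPolynomial (Fin 2) (Polynomial ℂ) →ₐ[Polynomial ℂ] _)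
  simp only [AlgEquiv.coe_toAlgHom] at k1 k2
  rw [← hi] at k1 k2
  let νK : MvPolynomial (Fin 2) (FractionRing (Polynomial ℂ)) ≃ₐ[FractionRing (Polynomial ℂ)]
      MvPolynomial (Fin 2) (FractionRing (Polynomial ℂ)) :=
    AlgEquiv.ofAlgHom (aeval (fun j => map i (ν (X j)))) (aeval (fun j => map i (ν.symm (X j))))
      (by
        apply algHom_ext
        intro j
        rw [AlgHom.comp_apply, aeval_X, k1, AlgEquiv.apply_symm_apply, map_X, AlgHom.id_apply])
      (by
        apply algHom_ext
        intro j
        rw [AlgHom.comp_apply, aeval_X, k2, AlgEquiv.symm_apply_apply, map_X, AlgHom.id_apply])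
  have hK : ∀ P, νK (map i P) = map i (ν P) := k1
  have hKC : ∀ a, νK (C a) = C a := algEquiv_C νK
  have hsm : ∀ P, map (sK : FractionRing (Polynomial ℂ) →+* FractionRing (Polynomial ℂ)) (map i P : MvPolynomial (Fin 2) _) = map i (map sR P) := by
    intro P
    rw [map_map, map_map]
    congr 2
    exact RingHom.ext sK_alg
  obtain ⟨u, v, hu, hv, huv⟩ := real_pair_field sK sK_sK (i (Polynomial.C Complex.I))
    (by rw [Ne, map_eq_zero_iff i hinj]; simp)
    (by rw [hi, sK_alg]; simp [sR]) νK (by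
      intro P
      have : ((νK : MvPolynomial (Fin 2) (FractionRing (Polynomial ℂ)) →+* _).comp
          (map (sK : FractionRing (Polynomial ℂ) →+* FractionRing (Polynomial ℂ)))).comp
          ((νK : MvPolynomial (Fin 2) (FractionRing (Polynomial ℂ)) →+* _).comp
          (map (sK : FractionRing (Polynomial ℂ) →+* FractionRing (Polynomial ℂ)))) = RingHom.id _ := by
        apply ringHom_ext
        · intro r
          change νK (map _ (νK (map _ (C r)))) = C r
          rw [map_C, hKC, map_C, hKC]
          exact congrArg C (sK_sK r)
        · intro j
          change νK (map _ (νK (map _ (X j)))) = X j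
          have e : (X j : MvPolynomial (Fin 2) (FractionRing (Polynomial ℂ))) = map i (X j) := (map_X _ _).symm
          rw [e, hsm, hK, hsm, hK, hν]
      exact congrArg (fun f => f P) this)
  have lift : ∀ w, νK (map (sK : FractionRing (Polynomial ℂ) →+* FractionRing (Polynomial ℂ)) w) = w → ∃ (D : Polynomial ℂ) (W : _), D ≠ 0 ∧
      C (i D) * w = map i W ∧ ν (map sR W) = W := by
    intro w hw
    obtain ⟨d, hd, w0, h0⟩ := clear_den w
    have hs : sR d ≠ 0 := fun h => hd (by rw [← sR_sR d, h, map_zero])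
    have e1 : C (i (d * sR d)) * w = map i (C (sR d) * w0) := by
      rw [map_mul (map i), map_C, map_mul i, C_mul, ← h0]; ring
    refine ⟨d * sR d, C (sR d) * w0, mul_ne_zero hd hs, e1, ?_⟩
    apply hminj
    rw [← hK, ← hsm, ← e1, map_mul, map_mul, hw, map_C, hKC]
    congr 2
    change sK (i (d * sR d)) = _
    rw [hi, sK_alg, map_mul, sR_sR, mul_comm]
  obtain ⟨D, U, hD, eU, hU⟩ := lift u hu
  obtain ⟨D', V, hD', eV, hV⟩ := lift v hv
  refine ⟨U, V, hU, hV, ?_⟩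
  have mem : ∀ (D : Polynomial ℂ) (w W), D ≠ 0 → C (i D) * w = map i W →
      map i W ∈ gen (FractionRing (Polynomial ℂ)) (map i U) (map i V) →
      w ∈ gen (FractionRing (Polynomial ℂ)) (map i U) (map i V) := by
    intro D w W hD e hm
    have hD' : i D ≠ 0 := by rwa [Ne, map_eq_zero_iff i hinj]
    have := Subalgebra.smul_mem _ hm (i D)⁻¹
    rwa [← e, smul_eq_C_mul, ← mul_assoc, ← C_mul, inv_mul_cancel₀ hD', C_1, one_mul] at this
  have htop : gen (FractionRing (Polynomial ℂ)) (map i U) (map i V) = ⊤ := by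
    rw [eq_top_iff, ← huv]
    exact gen_le (mem D u U hD eU (left_mem_gen _ _)) (mem D' v V hD' eV (right_mem_gen _ _))
  have fin : ∀ j, X j ∈ sat (gen (Polynomial ℂ) U V) := by
    intro j
    have hm : X j ∈ gen (FractionRing (Polynomial ℂ)) (map i U) (map i V) := by rw [htop]; trivial
    obtain ⟨H, hH⟩ := mem_gen.1 hm
    obtain ⟨d, hd, H0, h0⟩ := clear_den H
    refine mem_sat.2 ⟨d, hd, mem_gen.2 ⟨H0, ?_⟩⟩
    apply hminj
    rw [map_aeval2, ← h0, map_mul, hH, smul_eq_C_mul, map_mul, map_C, map_X, aeval_C, algebraMap_eq]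
  exact top_of_X (fin 0) (fin 1)

theorem main2 (ν : MvPolynomial (Fin 2) (Polynomial ℂ) ≃ₐ[Polynomial ℂ] MvPolynomial (Fin 2) (Polynomial ℂ))
    (hν : ∀ P, ν (map sR (ν (map sR P))) = P) :
    ∃ f : MvPolynomial (Fin 2) (Polynomial ℂ) ≃ₐ[Polynomial ℂ] MvPolynomial (Fin 2) (Polynomial ℂ),
      ∀ P, ν P = f.symm (map sR (f (map sR P))) := by
  have hss : ∀ P : MvPolynomial (Fin 2) (Polynomial ℂ), map sR (map sR P) = P := by
    intro P
    rw [map_map]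
    have : sR.comp sR = RingHom.id _ := RingHom.ext sR_sR
    rw [this, map_id]
  let τ : MvPolynomial (Fin 2) (Polynomial ℂ) →+* MvPolynomial (Fin 2) (Polynomial ℂ) :=
    (ν : MvPolynomial (Fin 2) (Polynomial ℂ) →+* MvPolynomial (Fin 2) (Polynomial ℂ)).comp (map sR)
  have hτ : ∀ P, τ P = ν (map sR P) := fun P => rfl
  have hτC : ∀ r, τ (C r) = C (sR r) := by
    intro r
    rw [hτ, map_C, ← algebraMap_eq]
    exact ν.commutes _
  obtain ⟨u, v, hu, hv, hG⟩ := fixed_pair ν hν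
  obtain ⟨u, v, hu, hv, hg⟩ := descent τ hτC _ u v rfl hu hv hG
  have hG : GP u v := eq_top_iff.2 (by rw [← hg]; exact le_sat _)
  let h : MvPolynomial (Fin 2) (Polynomial ℂ) ≃ₐ[Polynomial ℂ] MvPolynomial (Fin 2) (Polynomial ℂ) :=
    AlgEquiv.ofBijective (aeval ![u, v]) ⟨fun a b hab => alg_indep (GP_jac_ne hG) hab, fun x => by
      have : x ∈ gen (Polynomial ℂ) u v := by rw [hg]; trivial
      exact mem_gen.1 this⟩
  have key : ∀ P, ν (map sR (h P)) = h (map sR P) := fun P => tau_aeval τ hτC hu hv P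
  refine ⟨h.symm, fun P => ?_⟩
  rw [AlgEquiv.symm_symm, ← key, AlgEquiv.apply_symm_apply, hss]

/-- `ℂ[x,y,z] = ℂ[z][x,y]` -/
noncomputable def EE : MvPolynomial (Fin 3) ℂ ≃ₐ[ℂ] MvPolynomial (Fin 2) (Polynomial ℂ) :=
  (renameEquiv ℂ (finSuccEquivLast (n := 2))).trans (optionEquivRight ℂ (Fin 2))

lemma EE_last : EE (X 2) = C Polynomial.X := by
  have : finSuccEquivLast (n := 2) 2 = none := finSuccEquivLast_last
  simp [EE, this]

lemma EE_some (j : Fin 2) : EE (X j.castSucc) = X j := by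
  have : finSuccEquivLast (n := 2) j.castSucc = some j := finSuccEquivLast_castSucc j
  simp [EE, this]

lemma EE_C (a : ℂ) : EE (C a) = C (Polynomial.C a) := by
  rw [← algebraMap_eq, AlgEquiv.commutes]; rfl

lemma EE_conj (P : MvPolynomial (Fin 3) ℂ) : EE (map (starRingEnd ℂ) P) = map sR (EE P) := by
  have : (EE : MvPolynomial (Fin 3) ℂ →+* MvPolynomial (Fin 2) (Polynomial ℂ)).comp (map (starRingEnd ℂ)) =
      (map sR).comp (EE : MvPolynomial (Fin 3) ℂ →+* MvPolynomial (Fin 2) (Polynomial ℂ)) := by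
    apply ringHom_ext
    · intro r
      change EE (map (starRingEnd ℂ) (C r)) = map sR (EE (C r))
      rw [map_C, EE_C, EE_C, map_C]; simp [sR]
    · intro j
      change EE (map (starRingEnd ℂ) (X j)) = map sR (EE (X j))
      rw [map_X]
      refine Fin.lastCases ?_ (fun j => ?_) j
      · change EE (X 2) = map sR (EE (X 2))
        rw [EE_last, map_C]; simp [sR]
      · rw [EE_some, map_X]
  exact congrArg (fun f => f P) this

theorem main3 (ν : MvPolynomial (Fin 3) ℂ ≃ₐ[ℂ] MvPolynomial (Fin 3) ℂ) (hz : ν (X 2) = X 2)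
    (hcoc : ∀ P : MvPolynomial (Fin 3) ℂ, ν (map (starRingEnd ℂ) (ν (map (starRingEnd ℂ) P))) = P) :
    ∃ f : MvPolynomial (Fin 3) ℂ ≃ₐ[ℂ] MvPolynomial (Fin 3) ℂ,
      f (X 2) = X 2 ∧
      ∀ P : MvPolynomial (Fin 3) ℂ, ν P = f.symm (map (starRingEnd ℂ) (f (map (starRingEnd ℂ) P))) := by
  have hzs : EE.symm (C Polynomial.X) = X 2 := by rw [← EE_last, AlgEquiv.symm_apply_apply]
  let ν0 : MvPolynomial (Fin 2) (Polynomial ℂ) ≃ₐ[ℂ] MvPolynomial (Fin 2) (Polynomial ℂ) :=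
    EE.symm.trans (ν.trans EE)
  have h0 : ∀ P, ν0 P = EE (ν (EE.symm P)) := fun P => rfl
  have hr : ∀ r : Polynomial ℂ, ν0 (C r) = C r := by
    intro r
    have : (ν0 : MvPolynomial (Fin 2) (Polynomial ℂ) →+* MvPolynomial (Fin 2) (Polynomial ℂ)).comp C = C := by
      apply Polynomial.ringHom_ext
      · intro a
        exact ν0.commutes a
      · change ν0 (C Polynomial.X) = C Polynomial.X
        rw [h0, hzs, hz, EE_last]
    exact congrArg (fun f => f r) this
  let ν2 : MvPolynomial (Fin 2) (Polynomial ℂ) ≃ₐ[Polynomial ℂ] MvPolynomial (Fin 2) (Polynomial ℂ) :=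
    AlgEquiv.ofRingEquiv (f := ν0.toRingEquiv) hr
  have h2 : ∀ P, ν2 P = EE (ν (EE.symm P)) := fun P => rfl
  have hsy : ∀ P, EE.symm (map sR P) = map (starRingEnd ℂ) (EE.symm P) := by
    intro P
    rw [AlgEquiv.symm_apply_eq, EE_conj, AlgEquiv.apply_symm_apply]
  obtain ⟨f, hf⟩ := main2 ν2 (by
    intro P
    rw [h2, h2, hsy, hsy, AlgEquiv.symm_apply_apply, hcoc, AlgEquiv.apply_symm_apply])
  refine ⟨EE.trans ((f.restrictScalars ℂ).trans EE.symm), ?_, fun P => ?_⟩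
  · change EE.symm (f (EE (X 2))) = X 2
    have : f (C Polynomial.X) = C Polynomial.X := f.commutes Polynomial.X
    rw [EE_last, this, hzs]
  · change ν P = EE.symm (f.symm (EE (map (starRingEnd ℂ) (EE.symm (f (EE (map (starRingEnd ℂ) P)))))))
    rw [EE_conj, AlgEquiv.apply_symm_apply, EE_conj, ← hf, h2, AlgEquiv.symm_apply_apply, AlgEquiv.symm_apply_apply]

end RealForm

theorem H1_aut_fixing_z_trivial
    (ν : MvPolynomial (Fin 3) ℂ ≃ₐ[ℂ] MvPolynomial (Fin 3) ℂ) (hz : ν (X 2) = X 2)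
    (hcoc : ∀ P : MvPolynomial (Fin 3) ℂ, ν (coeffConj (ν (coeffConj P))) = P) :
    ∃ f : MvPolynomial (Fin 3) ℂ ≃ₐ[ℂ] MvPolynomial (Fin 3) ℂ,
      f (X 2) = X 2 ∧
      ∀ P : MvPolynomial (Fin 3) ℂ, ν P = f.symm (coeffConj (f (coeffConj P))) := by
  exact RealForm.main3 ν hz hcoc
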